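/- arXiv:2409.07247 — 10 statements merged into one kernel-verified Lean document; each statement's English description precedes it below -/
import Mathlib

section
/- Let A be a simply-laced generalized Cartan matrix and M₁,…,Mₙ a generalized spin representation on a finite-dimensional real vector space S. Then there exists a generalized Γ-matrix Γ : ℤⁿ → End(S) with respect to the form (α|β) = αᵀAβ and its standard 2-cocycle ε such that Γ(e_i) = Γ(−e_i) = 2·M_i for every i = 1,…,n; that is, Γ satisfies Γ(0) = id, Γ(−α) = Γ(α), Γ(α)² = (−1)^{(α|α)/2}·id, Γ(α)Γ(β) = (−1)^{(α|β)}·Γ(β)Γ(α), and Γ(α)Γ(β) = ε(α,β)·Γ(α+β) for all α, β ∈ ℤⁿ. -/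
open scoped BigOperators

noncomputable section

/-- The pairing `(α|β) = αᵀ B β` on `ℤⁿ` induced by an integer matrix `B`. -/
def pairB {n : ℕ} (B : Matrix (Fin n) (Fin n) ℤ) (α β : Fin n → ℤ) : ℤ :=
  ∑ i, ∑ j, α i * B i j * β j

/-- The bilinear form `ε̲` on `ℤⁿ` with `ε̲(e_i,e_j) = B_{ij}` for `i < j`,
`ε̲(e_i,e_i) = B_{ii}/2` and `ε̲(e_i,e_j) = 0` for `i > j`. -/
def epsU {n : ℕ} (B : Matrix (Fin n) (Fin n) ℤ) (α β : Fin n → ℤ) : ℤ :=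
  ∑ i, ∑ j, α i * β j * (if i < j then B i j else if i = j then B i i / 2 else 0)

/-- The standard 2-cocycle `ε(α,β) = (−1)^{ε̲(α,β)}` of `B`. -/
def stdCocycle {n : ℕ} (B : Matrix (Fin n) (Fin n) ℤ) (α β : Fin n → ℤ) : ℝ :=
  (-1 : ℝ) ^ epsU B α β

/-- A generalized Γ-matrix with respect to the form `(α|β) = αᵀBβ` and the standard
2-cocycle `ε` of `B`: `Γ(0) = id`, `Γ(−α) = Γ(α)`, `Γ(α)² = (−1)^{(α|α)/2}·id`,
`Γ(α)Γ(β) = (−1)^{(α|β)}·Γ(β)Γ(α)` and `Γ(α)Γ(β) = ε(α,β)·Γ(α+β)`. -/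
def IsGammaMatrix {n : ℕ} (B : Matrix (Fin n) (Fin n) ℤ) {S : Type*}
    [AddCommGroup S] [Module ℝ S] (Γ : (Fin n → ℤ) → Module.End ℝ S) : Prop :=
  Γ 0 = 1 ∧ (∀ α, Γ (-α) = Γ α) ∧
  (∀ α, Γ α * Γ α = ((-1 : ℝ) ^ (pairB B α α / 2)) • (1 : Module.End ℝ S)) ∧
  (∀ α β, Γ α * Γ β = ((-1 : ℝ) ^ pairB B α β) • (Γ β * Γ α)) ∧
  (∀ α β, Γ α * Γ β = stdCocycle B α β • Γ (α + β))

section ParityPow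

variable {R : Type*} [Ring R]

/-- The element `x` for odd exponents and `1` for even ones. -/
def parityPow (x : R) (a : ℤ) : R := if Even a then 1 else x

lemma parityPow_mul_parityPow [Algebra ℝ R] {x : R} (hx : x * x = -1) (a b : ℤ) :
    parityPow x a * parityPow x b = ((-1 : ℝ) ^ (a * b)) • parityPow x (a + b) := by
  unfold parityPow
  by_cases ha : Even a <;> by_cases hb : Even b
  · simp [ha, hb, Int.even_add, (ha.mul_right b).neg_one_zpow]
  · simp [ha, hb, Int.even_add, (ha.mul_right b).neg_one_zpow]
  · simp [ha, hb, Int.even_add, (hb.mul_left a).neg_one_zpow]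
  · have h : Odd (a * b) := (Int.not_even_iff_odd.mp ha).mul (Int.not_even_iff_odd.mp hb)
    simp [ha, hb, Int.even_add, h.neg_one_zpow, hx]

lemma parityPow_mul_comm [Algebra ℝ R] {x y : R} {c : ℤ} (h : x * y = ((-1 : ℝ) ^ c) • (y * x)) (a b : ℤ) :
    parityPow x a * parityPow y b =
      ((-1 : ℝ) ^ (a * b * c)) • (parityPow y b * parityPow x a) := by
  unfold parityPow
  by_cases ha : Even a
  · simp [ha, ((ha.mul_right b).mul_right c).neg_one_zpow]
  by_cases hb : Even b
  · simp [ha, hb, ((hb.mul_left a).mul_right c).neg_one_zpow]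
  have hab : Odd (a * b) := (Int.not_even_iff_odd.mp ha).mul (Int.not_even_iff_odd.mp hb)
  simp [ha, hb, zpow_mul, hab.neg_one_zpow, h]

/-- The product `x_{n-1}^{α_{n-1}} ⋯ x_0^{α_0}` with exponents read modulo `2`. -/
def descProd : {n : ℕ} → (Fin n → R) → (Fin n → ℤ) → R
  | 0, _, _ => 1
  | _ + 1, x, α => descProd (fun i => x i.succ) (fun i => α i.succ) * parityPow (x 0) (α 0)

lemma descProd_congr {n : ℕ} (x : Fin n → R) {α β : Fin n → ℤ}
    (h : ∀ i, Even (α i) ↔ Even (β i)) : descProd x α = descProd x β := by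
  induction n with
  | zero => rfl
  | succ n ih =>
    simp only [descProd, parityPow, h 0]
    rw [ih (fun i => x i.succ) (fun i => h i.succ)]

lemma descProd_of_even {n : ℕ} (x : Fin n → R) {α : Fin n → ℤ} (h : ∀ i, Even (α i)) :
    descProd x α = 1 := by
  induction n with
  | zero => rfl
  | succ n ih =>
    simp only [descProd, parityPow, h 0, if_true, mul_one]
    exact ih _ fun i => h i.succ

lemma descProd_single {n : ℕ} (x : Fin n → R) (i : Fin n) :
    descProd x (Pi.single i 1) = x i := by
  induction n with
  | zero => exact i.elim0
  | succ n ih =>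
    refine Fin.cases ?_ (fun j => ?_) i
    · rw [descProd, descProd_of_even _ (fun i => by simp)]
      simp [parityPow]
    · have h : (fun k : Fin n => (Pi.single j.succ 1 : Fin (n + 1) → ℤ) k.succ) =
          Pi.single j 1 := by
        ext k
        simp [Pi.single_apply]
      rw [descProd, h, ih]
      simp [parityPow, (Fin.succ_ne_zero j).symm]

lemma parityPow_mul_descProd [Algebra ℝ R] {n : ℕ} {y : R} {x : Fin n → R} {c : Fin n → ℤ}
    (h : ∀ i, y * x i = ((-1 : ℝ) ^ c i) • (x i * y)) (a : ℤ) (β : Fin n → ℤ) :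
    parityPow y a * descProd x β =
      ((-1 : ℝ) ^ ∑ i, a * β i * c i) • (descProd x β * parityPow y a) := by
  induction n with
  | zero => simp [descProd]
  | succ n ih =>
    rw [descProd, ← mul_assoc, ih (fun i => h i.succ), smul_mul_assoc, mul_assoc,
      parityPow_mul_comm (h 0), mul_smul_comm, smul_smul, ← mul_assoc, Fin.sum_univ_succ,
      zpow_add₀ (by norm_num), mul_comm (_ ^ (a * β 0 * c 0))]

end ParityPow

lemma epsU_succ {n : ℕ} (B : Matrix (Fin (n + 1)) (Fin (n + 1)) ℤ) (α β : Fin (n + 1) → ℤ) :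
    epsU B α β = α 0 * β 0 * (B 0 0 / 2) + ∑ j : Fin n, α 0 * β j.succ * B 0 j.succ +
      epsU (B.submatrix Fin.succ Fin.succ) (fun i => α i.succ) (fun i => β i.succ) := by
  simp [epsU, Fin.sum_univ_succ, Fin.succ_inj]

lemma epsU_add_epsU_swap {n : ℕ} {B : Matrix (Fin n) (Fin n) ℤ} (hsymm : ∀ i j, B i j = B j i)
    (heven : ∀ i, Even (B i i)) (α β : Fin n → ℤ) :
    epsU B α β + epsU B β α = pairB B α β := by
  unfold epsU pairB
  conv_lhs => rw [Finset.sum_comm (f := fun i j => β i * α j * _)]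
  simp only [← Finset.sum_add_distrib]
  refine Finset.sum_congr rfl fun i _ => Finset.sum_congr rfl fun j _ => ?_
  rcases lt_trichotomy i j with h | rfl | h
  · simp only [h, h.not_gt, h.ne', if_true, if_false]
    ring
  · obtain ⟨k, hk⟩ := heven i
    have : B i i / 2 = k := by omega
    simp only [lt_irrefl, if_true, if_false]
    rw [this, hk]
    ring
  · simp only [h, h.not_gt, h.ne', if_true, if_false, hsymm j i]
    ring

lemma descProd_mul_descProd {R : Type*} [Ring R] [Algebra ℝ R] {n : ℕ}
    {B : Matrix (Fin n) (Fin n) ℤ} {x : Fin n → R} (hdiag : ∀ i, B i i = 2)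
    (hsq : ∀ i, x i * x i = -1)
    (hcomm : ∀ i j, i < j → x i * x j = ((-1 : ℝ) ^ B i j) • (x j * x i)) (α β : Fin n → ℤ) :
    descProd x α * descProd x β = stdCocycle B α β • descProd x (α + β) := by
  induction n with
  | zero => simp [descProd, stdCocycle, epsU]
  | succ n ih =>
    have hrec := ih (B := B.submatrix Fin.succ Fin.succ) (x := fun i => x i.succ)
      (fun i => hdiag i.succ) (fun i => hsq i.succ)
      (fun i j hij => hcomm _ _ (Fin.succ_lt_succ_iff.mpr hij))
      (fun i => α i.succ) (fun i => β i.succ)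
    have hmove := parityPow_mul_descProd (fun j => hcomm 0 (Fin.succ j) (Fin.succ_pos j))
      (α 0) (fun i => β i.succ)
    simp only [descProd, Pi.add_apply]
    rw [mul_assoc, ← mul_assoc (parityPow _ _), hmove, smul_mul_assoc, mul_assoc,
      parityPow_mul_parityPow (hsq 0), mul_smul_comm, mul_smul_comm, mul_smul_comm,
      ← mul_assoc, hrec, smul_mul_assoc, smul_smul, smul_smul]
    congr 1
    have h2 : B 0 0 / 2 = 1 := by simp [hdiag 0]
    simp only [stdCocycle]
    rw [epsU_succ, h2, mul_one, zpow_add₀ (by norm_num), zpow_add₀ (by norm_num)]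
    ring

lemma isGammaMatrix_descProd {n : ℕ} {B : Matrix (Fin n) (Fin n) ℤ} {S : Type*}
    [AddCommGroup S] [Module ℝ S] {x : Fin n → Module.End ℝ S} (hdiag : ∀ i, B i i = 2)
    (hsymm : ∀ i j, B i j = B j i) (hsq : ∀ i, x i * x i = -1)
    (hcomm : ∀ i j, i < j → x i * x j = ((-1 : ℝ) ^ B i j) • (x j * x i)) :
    IsGammaMatrix B (descProd x) := by
  have hmul := descProd_mul_descProd hdiag hsq hcomm
  have hswap := epsU_add_epsU_swap hsymm (fun i => by simp [hdiag i])
  refine ⟨descProd_of_even _ fun i => by simp, fun α => descProd_congr _ fun i => by simp,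
    fun α => ?_, fun α β => ?_, hmul⟩
  · have h : pairB B α α / 2 = epsU B α α := by
      have := hswap α α
      omega
    rw [hmul, descProd_of_even _ (fun i => by simp), h, stdCocycle]
  · have hsign : stdCocycle B β α * stdCocycle B β α = 1 := by
      rw [stdCocycle, ← mul_zpow]
      simp
    rw [hmul, hmul β α, smul_smul, add_comm β α, ← hswap, zpow_add₀ (by norm_num)]
    change _ = (stdCocycle B α β * stdCocycle B β α * stdCocycle B β α) • _
    rw [mul_assoc, hsign, mul_one]

/-- Every generalized spin representation of a simply-laced GCM extends to a
generalized Γ-matrix with `Γ(±e_i) = 2·M_i`. -/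
theorem statement1 {n : ℕ} (A : Matrix (Fin n) (Fin n) ℤ)
    (hdiag : ∀ i, A i i = 2)
    (hoffdiag : ∀ i j, i ≠ j → A i j = 0 ∨ A i j = -1)
    (hzero : ∀ i j, A i j = 0 ↔ A j i = 0)
    {S : Type*} [AddCommGroup S] [Module ℝ S] [FiniteDimensional ℝ S]
    (M : Fin n → Module.End ℝ S)
    (hsq : ∀ i, M i * M i = (-(1/4 : ℝ)) • (1 : Module.End ℝ S))
    (hcomm : ∀ i j, i ≠ j → A i j = 0 → M i * M j = M j * M i)
    (hanti : ∀ i j, i ≠ j → A i j = -1 → M i * M j = -(M j * M i)) :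
    ∃ Γ : (Fin n → ℤ) → Module.End ℝ S, IsGammaMatrix A Γ ∧
      ∀ i, Γ (Pi.single i 1) = (2 : ℝ) • M i ∧ Γ (-(Pi.single i 1)) = (2 : ℝ) • M i := by
  have hsymm : ∀ i j, A i j = A j i := by
    intro i j
    by_cases hij : i = j
    · rw [hij]
    · have h := hzero i j
      have h₁ := hoffdiag i j hij
      have h₂ := hoffdiag j i (Ne.symm hij)
      omega
  have hΓ : IsGammaMatrix A (descProd fun i => (2 : ℝ) • M i) := by
    refine isGammaMatrix_descProd hdiag hsymm (fun i => ?_) (fun i j hij => ?_)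
    · rw [smul_mul_smul_comm, hsq, smul_smul]
      norm_num
    · simp only [smul_mul_smul_comm]
      rcases hoffdiag i j hij.ne with h | h
      · simp [h, hcomm i j hij.ne h]
      · simp [h, hanti i j hij.ne h]
  refine ⟨_, hΓ, fun i => ⟨descProd_single _ i, ?_⟩⟩
  rw [hΓ.2.1, descProd_single]
end
end

section
/- Let A be a simply-laced GCM and M₁,…,Mₙ a generalized spin representation on S. Let V be a real vector space, t₁,…,tₙ ∈ End(V), and for each pair i ≠ j with A_{ij} = −1 let u_{ij} = u_{ji} ∈ End(V), such that: t_i∘t_j = t_j∘t_i whenever A_{ij} = 0; t_i∘t_j + t_j∘t_i = u_{ij} whenever A_{ij} = −1; and t_i∘u_{ij} + u_{ij}∘t_i = t_j whenever A_{ij} = −1. Then the endomorphisms T_i := t_i ⊗ (2M_i) of V ⊗ S satisfy the Berman relations [T_i,T_j] = 0 whenever A_{ij} = 0 and [T_i,[T_i,T_j]] = −T_j whenever A_{ij} = −1 (i ≠ j); hence X_i ↦ T_i defines a finite-dimensional representation of 𝔨(A). -/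
open scoped TensorProduct

noncomputable section

/-- The commutator of pure tensors with commuting legs vanishes. -/
theorem TensorProduct.lie_map_map_of_commute {R V S : Type*} [CommRing R]
    [AddCommGroup V] [Module R V] [AddCommGroup S] [Module R S]
    {s t : Module.End R V} {a b : Module.End R S} (hst : s * t = t * s) (hab : a * b = b * a) :
    ⁅TensorProduct.map s a, TensorProduct.map t b⁆ = 0 := by
  rw [Ring.lie_def, ← TensorProduct.map_mul, ← TensorProduct.map_mul, hst, hab, sub_self]

theorem TensorProduct.map_neg_right_end {R V S : Type*} [CommRing R]
    [AddCommGroup V] [Module R V] [AddCommGroup S] [Module R S]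
    (s : Module.End R V) (a : Module.End R S) :
    TensorProduct.map s (-a) = -TensorProduct.map s a := by
  refine TensorProduct.ext' fun v x => ?_
  simp [TensorProduct.tmul_neg]

/-- If the second legs anticommute, the commutator of pure tensors is the anticommutator of the
first legs tensored with the product of the second legs. -/
theorem TensorProduct.lie_map_map_of_anticommute {R V S : Type*} [CommRing R]
    [AddCommGroup V] [Module R V] [AddCommGroup S] [Module R S]
    (s t : Module.End R V) {a b : Module.End R S} (hab : a * b = -(b * a)) :
    ⁅TensorProduct.map s a, TensorProduct.map t b⁆ =
      TensorProduct.map (s * t + t * s) (a * b) := by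
  have hba : b * a = -(a * b) := by rw [hab, neg_neg]
  rw [Ring.lie_def, ← TensorProduct.map_mul, ← TensorProduct.map_mul, hba,
    TensorProduct.map_neg_right_end, TensorProduct.map_add_left, sub_neg_eq_add]

/-- If `τ`-data (`t_i = τ(α_i)`, `u_{ij} = τ(α_i+α_j)`) satisfies the (anti-)commutation
relations, then the operators `T_i = t_i ⊗ 2M_i` on `V ⊗ S` satisfy the Berman relations
of `𝔨(A)` for a simply-laced GCM `A`. -/
theorem statement3 {n : ℕ} (A : Matrix (Fin n) (Fin n) ℤ)
    (hdiag : ∀ i, A i i = 2)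
    (hoffdiag : ∀ i j, i ≠ j → A i j = 0 ∨ A i j = -1)
    (hzero : ∀ i j, A i j = 0 ↔ A j i = 0)
    {S : Type*} [AddCommGroup S] [Module ℝ S] [FiniteDimensional ℝ S]
    (M : Fin n → Module.End ℝ S)
    (hsq : ∀ i, M i * M i = (-(1/4 : ℝ)) • (1 : Module.End ℝ S))
    (hcomm : ∀ i j, i ≠ j → A i j = 0 → M i * M j = M j * M i)
    (hanti : ∀ i j, i ≠ j → A i j = -1 → M i * M j = -(M j * M i))
    {V : Type*} [AddCommGroup V] [Module ℝ V]
    (t : Fin n → Module.End ℝ V)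
    (u : Fin n → Fin n → Module.End ℝ V)
    (husymm : ∀ i j, i ≠ j → A i j = -1 → u i j = u j i)
    (ht0 : ∀ i j, i ≠ j → A i j = 0 → t i * t j = t j * t i)
    (ht1 : ∀ i j, i ≠ j → A i j = -1 → t i * t j + t j * t i = u i j)
    (ht2 : ∀ i j, i ≠ j → A i j = -1 → t i * u i j + u i j * t i = t j) :
    ∀ i j, i ≠ j →
      (A i j = 0 →
        ⁅TensorProduct.map (t i) ((2:ℝ) • M i), TensorProduct.map (t j) ((2:ℝ) • M j)⁆ = 0) ∧
      (A i j = -1 →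
        ⁅TensorProduct.map (t i) ((2:ℝ) • M i),
          ⁅TensorProduct.map (t i) ((2:ℝ) • M i), TensorProduct.map (t j) ((2:ℝ) • M j)⁆⁆
          = -TensorProduct.map (t j) ((2:ℝ) • M j)) := by
  intro i j hij
  refine ⟨fun h => TensorProduct.lie_map_map_of_commute (ht0 i j hij h) ?_, fun h => ?_⟩
  · rw [smul_mul_smul_comm, smul_mul_smul_comm, hcomm i j hij h]
  have hab : ((2 : ℝ) • M i) * ((2 : ℝ) • M j) = -(((2 : ℝ) • M j) * ((2 : ℝ) • M i)) := by
    rw [smul_mul_smul_comm, smul_mul_smul_comm, hanti i j hij h, smul_neg]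
  have haa : ((2 : ℝ) • M i) * ((2 : ℝ) • M i) = -1 := by
    rw [smul_mul_smul_comm, hsq i, smul_smul]
    norm_num
  generalize (2 : ℝ) • M i = a at hab haa ⊢
  generalize (2 : ℝ) • M j = b at hab ⊢
  have haab : a * (a * b) = -(a * b * a) := by
    rw [mul_assoc, ← mul_neg, hab, mul_neg]
  rw [TensorProduct.lie_map_map_of_anticommute _ _ hab, ht1 i j hij h,
    TensorProduct.lie_map_map_of_anticommute _ _ haab, ht2 i j hij h, ← mul_assoc, haa,
    neg_one_mul, TensorProduct.map_neg_right_end]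
end
end

section
/- Let V be a finite-dimensional real vector space and η a linear representation on V of the symmetric group S₃ on three letters. Assume the sign-isotypic component of V is zero, i.e. the only v ∈ V with η(σ)(v) = sgn(σ)·v for all σ ∈ S₃ is v = 0. Then for the transpositions a = (1 2) and b = (2 3) one has η(a)∘η(b) + η(b)∘η(a) − η(a) − η(b) + id_V = η(b·a·b); equivalently, (η(a) − ½·id)∘(η(b) − ½·id) + (η(b) − ½·id)∘(η(a) − ½·id) = η(bab) − ½·id. -/
noncomputable section

/-- The alternating sum of a vector over a permutation group is sign-isotypic. -/
theorem Representation.apply_sum_sign_smul {k ι V : Type*} [CommRing k] [Fintype ι]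
    [DecidableEq ι] [AddCommGroup V] [Module k V] (η : Representation k (Equiv.Perm ι) V)
    (v : V) (τ : Equiv.Perm ι) :
    η τ (∑ σ, ((Equiv.Perm.sign σ : ℤ) : k) • η σ v) =
      ((Equiv.Perm.sign τ : ℤ) : k) • ∑ σ, ((Equiv.Perm.sign σ : ℤ) : k) • η σ v := by
  conv_rhs =>
    rw [← Equiv.sum_comp (Equiv.mulLeft τ) fun σ => ((Equiv.Perm.sign σ : ℤ) : k) • η σ v]
  rw [map_sum, Finset.smul_sum]
  refine Finset.sum_congr rfl fun σ _ => ?_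
  have hτ : ((Equiv.Perm.sign τ : ℤ) : k) * ((Equiv.Perm.sign τ : ℤ) : k) = 1 := by
    exact_mod_cast congrArg (fun u : ℤˣ => ((u : ℤ) : k)) (Int.units_mul_self (Equiv.Perm.sign τ))
  simp only [Equiv.coe_mulLeft, map_mul, Units.val_mul, Int.cast_mul, map_smul, smul_smul,
    ← mul_assoc, hτ, one_mul, Module.End.mul_apply]

theorem univ_perm_fin_three :
    (Finset.univ : Finset (Equiv.Perm (Fin 3))) =
      {1, Equiv.swap 0 1, Equiv.swap 1 2, Equiv.swap 0 1 * Equiv.swap 1 2,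
        Equiv.swap 1 2 * Equiv.swap 0 1,
        Equiv.swap 1 2 * Equiv.swap 0 1 * Equiv.swap 1 2} := by
  decide

/-- If a finite-dimensional real representation `η` of `S₃` has trivial sign-isotypic
component, then for the transpositions `a = (1 2)` and `b = (2 3)` one has
`η(a)η(b) + η(b)η(a) − η(a) − η(b) + 1 = η(bab)`. -/
theorem statement4 {V : Type*} [AddCommGroup V] [Module ℝ V] [FiniteDimensional ℝ V]
    (η : Representation ℝ (Equiv.Perm (Fin 3)) V)
    (hsign : ∀ v : V,
      (∀ σ : Equiv.Perm (Fin 3), η σ v = ((Equiv.Perm.sign σ : ℤ) : ℝ) • v) → v = 0) :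
    η (Equiv.swap 0 1) * η (Equiv.swap 1 2) + η (Equiv.swap 1 2) * η (Equiv.swap 0 1)
        - η (Equiv.swap 0 1) - η (Equiv.swap 1 2) + 1
      = η (Equiv.swap 1 2 * Equiv.swap 0 1 * Equiv.swap 1 2) := by
  ext v
  have hsum := hsign _ (η.apply_sum_sign_smul v)
  have h01 : Equiv.Perm.sign (Equiv.swap (0 : Fin 3) 1) = -1 := Equiv.Perm.sign_swap (by decide)
  have h12 : Equiv.Perm.sign (Equiv.swap (1 : Fin 3) 2) = -1 := Equiv.Perm.sign_swap (by decide)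
  rw [univ_perm_fin_three, Finset.sum_insert (by decide), Finset.sum_insert (by decide),
    Finset.sum_insert (by decide), Finset.sum_insert (by decide),
    Finset.sum_insert (by decide), Finset.sum_singleton] at hsum
  simp only [map_mul, map_one, h01, h12, Module.End.mul_apply, Module.End.one_apply,
    LinearMap.add_apply, LinearMap.sub_apply, mul_neg, mul_one, neg_neg, Units.val_neg,
    Units.val_one, Int.cast_neg, Int.cast_one, neg_smul, one_smul] at hsum ⊢
  rw [← sub_eq_zero, ← hsum]
  abel
end
end

section
/- Let A be a simply-laced GCM, let (V, b, α₁,…,αₙ) be a realization of A, and let M₁,…,Mₙ be a generalized spin representation on S. Set T_i := (s_i − ½·id_V) ⊗ (2M_i) ∈ End(V ⊗ S). Then the T_i satisfy the Berman relations: [T_i,T_j] = 0 whenever A_{ij} = 0 and [T_i,[T_i,T_j]] = −T_j whenever A_{ij} = −1 (i ≠ j). Hence X_i ↦ T_i defines a finite-dimensional representation of 𝔨(A), the 3/2-spin representation 𝒮_{3/2}. -/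
open scoped TensorProduct

noncomputable section

/-- The reflection `s_α(v) = v − b(α,v)·α`. -/
def reflB {V : Type*} [AddCommGroup V] [Module ℝ V]
    (b : LinearMap.BilinForm ℝ V) (α : V) : Module.End ℝ V :=
  LinearMap.id - LinearMap.smulRight (b α) α

/-- The bracket of two elements of `End V ⊗ End S` with commuting factors vanishes. -/
theorem lie_tensorMap_eq_zero {R V S : Type*} [CommRing R] [AddCommGroup V] [Module R V]
    [AddCommGroup S] [Module R S] {f g : Module.End R V} {N K : Module.End R S}
    (hfg : f * g = g * f) (hNK : N * K = K * N) :
    ⁅TensorProduct.map f N, TensorProduct.map g K⁆ = 0 := by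
  rw [Ring.lie_def, ← TensorProduct.map_mul, ← TensorProduct.map_mul, hfg, hNK, sub_self]

/-- If `N² = -1` and `N`, `K` anticommute, the double bracket of `f ⊗ N` with `g ⊗ K` is
`-{f, {f, g}} ⊗ K`. -/
theorem lie_lie_tensorMap {R V S : Type*} [CommRing R] [AddCommGroup V] [Module R V]
    [AddCommGroup S] [Module R S] (f g : Module.End R V) {N K : Module.End R S}
    (hN : N * N = -1) (hNK : N * K = -(K * N)) :
    ⁅TensorProduct.map f N, ⁅TensorProduct.map f N, TensorProduct.map g K⁆⁆
      = -TensorProduct.map (f * (f * g + g * f) + (f * g + g * f) * f) K := by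
  have hl : N * (N * K) = -K := by rw [← mul_assoc, hN, neg_one_mul]
  have hr : N * K * N = K := by rw [hNK, neg_mul, mul_assoc, hN, mul_neg_one, neg_neg]
  have hinner : ⁅TensorProduct.map f N, TensorProduct.map g K⁆
      = TensorProduct.map (f * g + g * f) (N * K) := by
    rw [Ring.lie_def, ← TensorProduct.map_mul, ← TensorProduct.map_mul, hNK,
      TensorProduct.map_add_left, ← neg_one_smul R (K * N), TensorProduct.map_smul_right,
      TensorProduct.map_smul_right]
    module
  rw [hinner, Ring.lie_def, ← TensorProduct.map_mul, ← TensorProduct.map_mul, hl, hr,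
    TensorProduct.map_add_left _ _ K, ← neg_one_smul R K, TensorProduct.map_smul_right]
  module

section Reflection

variable {V : Type*} [AddCommGroup V] [Module ℝ V] {b : LinearMap.BilinForm ℝ V} {x y : V}

/-- Reflections in orthogonal vectors, shifted by scalars, commute. -/
theorem reflB_sub_half_commute (hxy : b x y = 0) (hyx : b y x = 0) :
    (reflB b x - (1/2 : ℝ) • 1) * (reflB b y - (1/2 : ℝ) • 1)
      = (reflB b y - (1/2 : ℝ) • 1) * (reflB b x - (1/2 : ℝ) • 1) := by
  ext v
  simp [reflB, hxy, hyx]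
  module

/-- For roots `x`, `y` with `b(x,y) = -1`, the shifted reflections `f = s_x - ½`, `g = s_y - ½`
satisfy `{f, {f, g}} = g`. -/
theorem reflB_sub_half_anticomm_anticomm (hxx : b x x = 2) (hxy : b x y = -1)
    (hyx : b y x = -1) :
    (reflB b x - (1/2 : ℝ) • 1) * ((reflB b x - (1/2 : ℝ) • 1) * (reflB b y - (1/2 : ℝ) • 1)
        + (reflB b y - (1/2 : ℝ) • 1) * (reflB b x - (1/2 : ℝ) • 1))
      + ((reflB b x - (1/2 : ℝ) • 1) * (reflB b y - (1/2 : ℝ) • 1)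
        + (reflB b y - (1/2 : ℝ) • 1) * (reflB b x - (1/2 : ℝ) • 1))
          * (reflB b x - (1/2 : ℝ) • 1)
      = reflB b y - (1/2 : ℝ) • 1 := by
  ext v
  simp [reflB, hxx, hxy, hyx]
  module

end Reflection

/-- The 3/2-spin representation: for a simply-laced GCM `A` with realization
`(V, b, α₁,…,αₙ)` and a generalized spin representation `M₁,…,Mₙ` on `S`, the operators
`T_i = (s_i − ½·id) ⊗ (2M_i)` on `V ⊗ S` satisfy the Berman relations of `𝔨(A)`. -/
theorem statement6 {n : ℕ} (A : Matrix (Fin n) (Fin n) ℤ)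
    (hdiag : ∀ i, A i i = 2)
    (hoffdiag : ∀ i j, i ≠ j → A i j = 0 ∨ A i j = -1)
    (hzero : ∀ i j, A i j = 0 ↔ A j i = 0)
    {V : Type*} [AddCommGroup V] [Module ℝ V] [FiniteDimensional ℝ V]
    (b : LinearMap.BilinForm ℝ V) (hb : b.IsSymm)
    (α : Fin n → V) (hli : LinearIndependent ℝ α)
    (hreal : ∀ i j, b (α i) (α j) = (A i j : ℝ))
    {S : Type*} [AddCommGroup S] [Module ℝ S] [FiniteDimensional ℝ S]
    (M : Fin n → Module.End ℝ S)
    (hsq : ∀ i, M i * M i = (-(1/4 : ℝ)) • (1 : Module.End ℝ S))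
    (hcomm : ∀ i j, i ≠ j → A i j = 0 → M i * M j = M j * M i)
    (hanti : ∀ i j, i ≠ j → A i j = -1 → M i * M j = -(M j * M i)) :
    ∀ i j, i ≠ j →
      (A i j = 0 →
        ⁅TensorProduct.map (reflB b (α i) - (1/2 : ℝ) • 1) ((2:ℝ) • M i),
          TensorProduct.map (reflB b (α j) - (1/2 : ℝ) • 1) ((2:ℝ) • M j)⁆ = 0) ∧
      (A i j = -1 →
        ⁅TensorProduct.map (reflB b (α i) - (1/2 : ℝ) • 1) ((2:ℝ) • M i),
          ⁅TensorProduct.map (reflB b (α i) - (1/2 : ℝ) • 1) ((2:ℝ) • M i),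
            TensorProduct.map (reflB b (α j) - (1/2 : ℝ) • 1) ((2:ℝ) • M j)⁆⁆
          = -TensorProduct.map (reflB b (α j) - (1/2 : ℝ) • 1) ((2:ℝ) • M j)) := by
  intro i j hij
  refine ⟨fun h => ?_, fun h => ?_⟩
  · have hxy : b (α i) (α j) = 0 := by simp [hreal, h]
    have hyx : b (α j) (α i) = 0 := by rw [hb.eq, hxy]
    refine lie_tensorMap_eq_zero (reflB_sub_half_commute hxy hyx) ?_
    rw [smul_mul_smul_comm, smul_mul_smul_comm, hcomm i j hij h]
  · have hxx : b (α i) (α i) = 2 := by simp [hreal, hdiag]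
    have hxy : b (α i) (α j) = -1 := by simp [hreal, h]
    have hyx : b (α j) (α i) = -1 := by rw [hb.eq, hxy]
    rw [lie_lie_tensorMap, reflB_sub_half_anticomm_anticomm hxx hxy hyx]
    · rw [smul_mul_smul_comm, hsq]
      module
    · rw [smul_mul_smul_comm, smul_mul_smul_comm, hanti i j hij h, smul_neg]
end
end

section
/- Let A be a simply-laced GCM, (V, b, α₁,…,αₙ) a realization of A, and M₁,…,Mₙ a generalized spin representation on S. On (V ⊗ V) ⊗ S set T_i := ((s_i ⊗ s_i) − ½·id) ⊗ (2M_i). Then each T_i maps the subspace Sym²(V) ⊗ S to itself, where Sym²(V) ⊆ V ⊗ V is the space of tensors fixed by the flip of factors, and on this subspace the Berman relations hold: for every flip-fixed w ∈ V ⊗ V and u ∈ S, [T_i,T_j](w ⊗ u) = 0 whenever A_{ij} = 0 and [T_i,[T_i,T_j]](w ⊗ u) = −T_j(w ⊗ u) whenever A_{ij} = −1 (i ≠ j). Hence the restriction X_i ↦ T_i|_{Sym²(V)⊗S} defines the 5/2-spin representation 𝒮_{5/2} of 𝔨(A). -/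
open scoped TensorProduct

noncomputable section

/-- The operator `T = ((s_α ⊗ s_α) − ½·id) ⊗ (2M)` on `(V ⊗ V) ⊗ S`. -/
def T52 {V : Type*} [AddCommGroup V] [Module ℝ V]
    {S : Type*} [AddCommGroup S] [Module ℝ S]
    (b : LinearMap.BilinForm ℝ V) (α : V) (M : Module.End ℝ S) :
    Module.End ℝ ((V ⊗[ℝ] V) ⊗[ℝ] S) :=
  TensorProduct.map (TensorProduct.map (reflB b α) (reflB b α) - (1/2 : ℝ) • 1) ((2:ℝ) • M)

/-- The flip of the two `V`-factors, extended by the identity on `S`. -/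
def flipS {V : Type*} [AddCommGroup V] [Module ℝ V]
    {S : Type*} [AddCommGroup S] [Module ℝ S] :
    Module.End ℝ ((V ⊗[ℝ] V) ⊗[ℝ] S) :=
  TensorProduct.map (TensorProduct.comm ℝ V V).toLinearMap LinearMap.id

theorem reflB_apply {V : Type*} [AddCommGroup V] [Module ℝ V]
    (b : LinearMap.BilinForm ℝ V) (α v : V) : reflB b α v = v - b α v • α := by
  simp [reflB]

theorem reflB_mul_self {V : Type*} [AddCommGroup V] [Module ℝ V]
    (b : LinearMap.BilinForm ℝ V) {α : V} (hα : b α α = 2) : reflB b α * reflB b α = 1 := by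
  ext v
  simp only [Module.End.mul_apply, reflB_apply, map_sub, map_smul, hα,
    Module.End.one_apply]
  module

theorem reflB_commute {V : Type*} [AddCommGroup V] [Module ℝ V]
    (b : LinearMap.BilinForm ℝ V) {α β : V} (hαβ : b α β = 0) (hβα : b β α = 0) :
    Commute (reflB b α) (reflB b β) := by
  ext v
  simp only [Module.End.mul_apply, reflB_apply, map_sub, map_smul, hαβ, hβα]
  module

/-- For roots with `b α β = -1`, the operators `P = s_α ⊗ s_α` and `Q = s_β ⊗ s_β` satisfy
`(1 - P) Q (1 - P) = 1 - P` on symmetric tensors. -/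
theorem one_sub_map_reflB_mul_mul_apply {V : Type*} [AddCommGroup V] [Module ℝ V]
    (b : LinearMap.BilinForm ℝ V) {α β : V} (hα : b α α = 2)
    (hαβ : b α β = -1) (hβα : b β α = -1) {w : V ⊗[ℝ] V} (hw : TensorProduct.comm ℝ V V w = w) :
    ((1 - TensorProduct.map (reflB b α) (reflB b α) : Module.End ℝ (V ⊗[ℝ] V)) *
        TensorProduct.map (reflB b β) (reflB b β) *
        (1 - TensorProduct.map (reflB b α) (reflB b α))) w =
      (1 - TensorProduct.map (reflB b α) (reflB b α) : Module.End ℝ (V ⊗[ℝ] V)) w := by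
  set D : Module.End ℝ (V ⊗[ℝ] V) := 1 - TensorProduct.map (reflB b α) (reflB b α) with hD
  set Q : Module.End ℝ (V ⊗[ℝ] V) := TensorProduct.map (reflB b β) (reflB b β) with hQ
  have key : (D * Q * D - D) ∘ₗ (LinearMap.id + (TensorProduct.comm ℝ V V).toLinearMap) = 0 := by
    refine TensorProduct.ext' fun x y => ?_
    simp only [hD, hQ, LinearMap.comp_apply, LinearMap.add_apply, LinearMap.sub_apply,
      LinearMap.id_apply, LinearEquiv.coe_coe, TensorProduct.comm_tmul, Module.End.mul_apply,
      Module.End.one_apply, map_add, map_sub, TensorProduct.map_tmul, reflB_apply, map_smul,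
      hα, hαβ, hβα, TensorProduct.tmul_sub, TensorProduct.sub_tmul,
      TensorProduct.tmul_smul, ← TensorProduct.smul_tmul', LinearMap.zero_apply]
    module
  have h := LinearMap.congr_fun key w
  simp only [LinearMap.comp_apply, LinearMap.add_apply, LinearMap.id_apply, LinearEquiv.coe_coe,
    hw, LinearMap.zero_apply, ← two_smul ℝ w, map_smul] at h
  exact sub_eq_zero.mp ((smul_eq_zero.mp h).resolve_left two_ne_zero)

theorem flipS_commute_T52 {V : Type*} [AddCommGroup V] [Module ℝ V]
    {S : Type*} [AddCommGroup S] [Module ℝ S]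
    (b : LinearMap.BilinForm ℝ V) (α : V) (M : Module.End ℝ S) :
    Commute (flipS (V := V) (S := S)) (T52 b α M) := by
  refine TensorProduct.ext_threefold fun x y u => ?_
  simp [flipS, T52, TensorProduct.sub_tmul]

theorem T52_commute {V : Type*} [AddCommGroup V] [Module ℝ V]
    {S : Type*} [AddCommGroup S] [Module ℝ S] (b : LinearMap.BilinForm ℝ V) {α β : V}
    (hαβ : b α β = 0) (hβα : b β α = 0) {M N : Module.End ℝ S} (hMN : Commute M N) :
    Commute (T52 b α M) (T52 b β N) := by
  have hPQ : Commute (TensorProduct.map (reflB b α) (reflB b α))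
      (TensorProduct.map (reflB b β) (reflB b β)) := by
    rw [Commute, SemiconjBy, ← TensorProduct.map_mul, ← TensorProduct.map_mul,
      (reflB_commute b hαβ hβα).eq]
  have hXY : Commute (TensorProduct.map (reflB b α) (reflB b α) - (1/2 : ℝ) • 1)
      (TensorProduct.map (reflB b β) (reflB b β) - (1/2 : ℝ) • 1) :=
    (hPQ.sub_left ((Commute.one_left _).smul_left _)).sub_right
      ((Commute.one_right _).smul_right _)
  rw [Commute, SemiconjBy, T52, T52, ← TensorProduct.map_mul, ← TensorProduct.map_mul, hXY.eq,
    ((hMN.smul_left (2 : ℝ)).smul_right (2 : ℝ)).eq]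

/-- The double commutator of decomposable operators whose second factors anticommute. -/
theorem lie_lie_map_of_anticommute {W S : Type*} [AddCommGroup W] [Module ℝ W]
    [AddCommGroup S] [Module ℝ S] (X Y : Module.End ℝ W) {m k : Module.End ℝ S}
    (hm : m * m = -1) (hmk : m * k = -(k * m)) :
    ⁅TensorProduct.map X m, ⁅TensorProduct.map X m, TensorProduct.map Y k⁆⁆ =
      -TensorProduct.map (X * X * Y + (2 : ℝ) • (X * Y * X) + Y * X * X) k := by
  have hkm : k * m = -(m * k) := by rw [hmk, neg_neg]
  have hmmk : m * (m * k) = -k := by rw [← mul_assoc, hm, neg_one_mul]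
  have hmkm : m * (k * m) = k := by rw [hkm, mul_neg, hmmk, neg_neg]
  have hkmm : k * (m * m) = -k := by rw [hm, mul_neg_one]
  simp only [Ring.lie_def, mul_sub, sub_mul, ← TensorProduct.map_mul, mul_assoc, hmmk, hmkm, hkmm]
  refine TensorProduct.ext' fun w u => ?_
  simp only [LinearMap.sub_apply, LinearMap.neg_apply, TensorProduct.map_tmul, LinearMap.add_apply,
    LinearMap.smul_apply, TensorProduct.tmul_neg, TensorProduct.add_tmul,
    ← TensorProduct.smul_tmul']
  module

/-- For an involution `P`, the Berman-type expression in `P - 1/2` and `Q - 1/2` differs from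
`Q - 1/2` by a multiple of `(1 - P) Q (1 - P) - (1 - P)`. -/
theorem berman_expression_eq {R : Type*} [Ring R] [Algebra ℝ R] {P : R} (Q : R) (hP : P * P = 1) :
    (P - (1/2 : ℝ) • 1) * (P - (1/2 : ℝ) • 1) * (Q - (1/2 : ℝ) • 1) +
        (2 : ℝ) • ((P - (1/2 : ℝ) • 1) * (Q - (1/2 : ℝ) • 1) * (P - (1/2 : ℝ) • 1)) +
        (Q - (1/2 : ℝ) • 1) * (P - (1/2 : ℝ) • 1) * (P - (1/2 : ℝ) • 1) =
      (Q - (1/2 : ℝ) • 1) + (2 : ℝ) • ((1 - P) * Q * (1 - P) - (1 - P)) := by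
  simp only [mul_sub, sub_mul, mul_smul_comm, smul_mul_assoc, one_mul, mul_one, mul_assoc, hP,
    smul_sub, smul_smul]
  module

theorem T52_lie_lie_tmul {V : Type*} [AddCommGroup V] [Module ℝ V]
    {S : Type*} [AddCommGroup S] [Module ℝ S] (b : LinearMap.BilinForm ℝ V) {α β : V}
    (hα : b α α = 2) (hαβ : b α β = -1) (hβα : b β α = -1) {M N : Module.End ℝ S}
    (hM : M * M = (-(1/4 : ℝ)) • (1 : Module.End ℝ S)) (hMN : M * N = -(N * M))
    {w : V ⊗[ℝ] V} (hw : TensorProduct.comm ℝ V V w = w) (u : S) :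
    ⁅T52 b α M, ⁅T52 b α M, T52 b β N⁆⁆ (w ⊗ₜ u) = -(T52 b β N (w ⊗ₜ u)) := by
  have hm : ((2 : ℝ) • M) * ((2 : ℝ) • M) = -1 := by
    rw [smul_mul_smul_comm, hM]
    module
  have hmk : ((2 : ℝ) • M) * ((2 : ℝ) • N) = -(((2 : ℝ) • N) * ((2 : ℝ) • M)) := by
    rw [smul_mul_smul_comm, smul_mul_smul_comm, hMN, smul_neg]
  have hP : TensorProduct.map (reflB b α) (reflB b α) *
      TensorProduct.map (reflB b α) (reflB b α) = 1 := by
    rw [← TensorProduct.map_mul, reflB_mul_self b hα, TensorProduct.map_one]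
  have hsym := one_sub_map_reflB_mul_mul_apply b hα hαβ hβα hw
  rw [T52, T52, lie_lie_map_of_anticommute _ _ hm hmk, berman_expression_eq _ hP,
    LinearMap.neg_apply, TensorProduct.map_tmul, TensorProduct.map_tmul, LinearMap.add_apply,
    LinearMap.smul_apply, LinearMap.sub_apply _ (1 - _), hsym, sub_self, smul_zero, add_zero]

/-- The 5/2-spin representation: the operators `T_i = ((s_i⊗s_i) − ½·id) ⊗ (2M_i)`
preserve the subspace `Sym²(V) ⊗ S` (the fixed space of the flip of the `V`-factors)
and the Berman relations hold there. -/
theorem statement7 {n : ℕ} (A : Matrix (Fin n) (Fin n) ℤ)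
    (hdiag : ∀ i, A i i = 2)
    (hoffdiag : ∀ i j, i ≠ j → A i j = 0 ∨ A i j = -1)
    (hzero : ∀ i j, A i j = 0 ↔ A j i = 0)
    {V : Type*} [AddCommGroup V] [Module ℝ V] [FiniteDimensional ℝ V]
    (b : LinearMap.BilinForm ℝ V) (hb : b.IsSymm)
    (α : Fin n → V) (hli : LinearIndependent ℝ α)
    (hreal : ∀ i j, b (α i) (α j) = (A i j : ℝ))
    {S : Type*} [AddCommGroup S] [Module ℝ S] [FiniteDimensional ℝ S]
    (M : Fin n → Module.End ℝ S)
    (hsq : ∀ i, M i * M i = (-(1/4 : ℝ)) • (1 : Module.End ℝ S))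
    (hcomm : ∀ i j, i ≠ j → A i j = 0 → M i * M j = M j * M i)
    (hanti : ∀ i j, i ≠ j → A i j = -1 → M i * M j = -(M j * M i)) :
    (∀ i, ∀ x ∈ LinearMap.eqLocus (flipS (V := V) (S := S)) (LinearMap.id),
        T52 b (α i) (M i) x ∈ LinearMap.eqLocus (flipS (V := V) (S := S)) (LinearMap.id)) ∧
    (∀ i j, i ≠ j → ∀ (w : V ⊗[ℝ] V) (u : S), (TensorProduct.comm ℝ V V) w = w →
      (A i j = 0 → ⁅T52 b (α i) (M i), T52 b (α j) (M j)⁆ (w ⊗ₜ u) = 0) ∧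
      (A i j = -1 →
        ⁅T52 b (α i) (M i), ⁅T52 b (α i) (M i), T52 b (α j) (M j)⁆⁆ (w ⊗ₜ u)
          = -(T52 b (α j) (M j) (w ⊗ₜ u)))) := by
  have hroot : ∀ i, b (α i) (α i) = 2 := fun i => by rw [hreal, hdiag]; norm_num
  refine ⟨fun i x hx => ?_, fun i j hij w u hw => ⟨fun h => ?_, fun h => ?_⟩⟩
  · rw [LinearMap.mem_eqLocus] at hx ⊢
    rw [← Module.End.mul_apply, (flipS_commute_T52 b (α i) (M i)).eq, Module.End.mul_apply, hx,
      LinearMap.id_apply, LinearMap.id_apply]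
  · have hαβ : b (α i) (α j) = 0 := by rw [hreal, h, Int.cast_zero]
    have hβα : b (α j) (α i) = 0 := by rw [← hαβ]; exact hb.eq (α j) (α i)
    rw [Ring.lie_def, (T52_commute b hαβ hβα (hcomm i j hij h)).eq, sub_self,
      LinearMap.zero_apply]
  · have hαβ : b (α i) (α j) = -1 := by rw [hreal, h]; norm_num
    have hβα : b (α j) (α i) = -1 := by rw [← hαβ]; exact hb.eq (α j) (α i)
    exact T52_lie_lie_tmul b (hroot i) hαβ hβα (hsq i) (hanti i j hij h) hw u
end
end

section
/- Let V and S be real vector spaces, s ∈ End(V) with s∘s = id, and M ∈ End(S) with M∘M = −¼·id. Set T := (s − ½·id_V) ⊗ (2M) ∈ End(V ⊗ S). Then the following operator identities hold: id_V ⊗ M = (2/3)·T³ + (7/6)·T; s ⊗ id_S = −(20/9)·T⁴ − (41/9)·T²; and id_V ⊗ id_S = −(16/9)·T⁴ − (40/9)·T². -/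
open scoped TensorProduct

noncomputable section

/-- For an involution `s` on `V` and `M` on `S` with `M² = −¼·id`, the operator
`T = (s − ½·id) ⊗ (2M)` satisfies the polynomial identities that recover
`id ⊗ M`, `s ⊗ id` and `id ⊗ id` from powers of `T`. -/
theorem statement11 {V S : Type*} [AddCommGroup V] [Module ℝ V]
    [AddCommGroup S] [Module ℝ S]
    (s : Module.End ℝ V) (hs : s * s = 1)
    (M : Module.End ℝ S) (hM : M * M = (-(1/4 : ℝ)) • (1 : Module.End ℝ S)) :
    TensorProduct.map (1 : Module.End ℝ V) M
        = (2/3 : ℝ) • (TensorProduct.map (s - (1/2 : ℝ) • 1) ((2:ℝ) • M)) ^ 3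
          + (7/6 : ℝ) • TensorProduct.map (s - (1/2 : ℝ) • 1) ((2:ℝ) • M) ∧
    TensorProduct.map s (1 : Module.End ℝ S)
        = (-(20/9) : ℝ) • (TensorProduct.map (s - (1/2 : ℝ) • 1) ((2:ℝ) • M)) ^ 4
          + (-(41/9) : ℝ) • (TensorProduct.map (s - (1/2 : ℝ) • 1) ((2:ℝ) • M)) ^ 2 ∧
    (1 : Module.End ℝ (V ⊗[ℝ] S))
        = (-(16/9) : ℝ) • (TensorProduct.map (s - (1/2 : ℝ) • 1) ((2:ℝ) • M)) ^ 4
          + (-(40/9) : ℝ) • (TensorProduct.map (s - (1/2 : ℝ) • 1) ((2:ℝ) • M)) ^ 2 := by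
  set A : Module.End ℝ (V ⊗[ℝ] S) := TensorProduct.map s 1 with hA
  set B : Module.End ℝ (V ⊗[ℝ] S) := TensorProduct.map 1 M with hB
  set T : Module.End ℝ (V ⊗[ℝ] S) :=
    TensorProduct.map (s - (1/2 : ℝ) • 1) ((2:ℝ) • M) with hT
  have hAA : A * A = 1 := by
    rw [hA, ← TensorProduct.map_mul, hs, one_mul, TensorProduct.map_one]
  have hBB : B * B = (-(1/4 : ℝ)) • 1 := by
    rw [hB, ← TensorProduct.map_mul, hM, one_mul, TensorProduct.map_smul_right,
      TensorProduct.map_one]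
  have hBA : B * A = A * B := by
    simp only [hA, hB, ← TensorProduct.map_mul, one_mul, mul_one]
  have hTAB : T = (2:ℝ) • (A * B) - B := by
    rw [hT, hA, hB, ← TensorProduct.map_mul, one_mul, mul_one, sub_eq_add_neg, ← neg_smul,
      TensorProduct.map_add_left, TensorProduct.map_smul_left, TensorProduct.map_smul_right,
      TensorProduct.map_smul_right]
    module
  have hAAB : A * (A * B) = B := by rw [← mul_assoc, hAA, one_mul]
  have hABAB : A * B * (A * B) = (-(1/4 : ℝ)) • 1 := by
    rw [mul_assoc, ← mul_assoc B, hBA, mul_assoc, hBB, ← mul_assoc, hAA, one_mul]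
  have hABB : A * B * B = (-(1/4 : ℝ)) • A := by
    rw [mul_assoc, hBB, mul_smul_comm, mul_one]
  have hBAB : B * (A * B) = (-(1/4 : ℝ)) • A := by
    rw [← mul_assoc, hBA, hABB]
  have hT2 : T ^ 2 = A - (5/4 : ℝ) • 1 := by
    rw [pow_two, hTAB]
    simp only [sub_mul, mul_sub, smul_mul_assoc, mul_smul_comm, hABAB, hABB, hBAB, hBB]
    module
  have hT3 : T ^ 3 = (13/4 : ℝ) • B - (7/2 : ℝ) • (A * B) := by
    rw [pow_succ, hT2, hTAB]
    simp only [sub_mul, mul_sub, smul_mul_assoc, mul_smul_comm, hAAB, one_mul]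
    module
  have hT4 : T ^ 4 = (41/16 : ℝ) • 1 - (5/2 : ℝ) • A := by
    rw [show T ^ 4 = T ^ 2 * T ^ 2 from pow_add T 2 2, hT2]
    simp only [sub_mul, mul_sub, smul_mul_assoc, mul_smul_comm, hAA, mul_one, one_mul]
    module
  refine ⟨?_, ?_, ?_⟩
  · rw [hT3, hTAB]
    module
  · rw [hT4, hT2]
    module
  · rw [hT4, hT2]
    module
end
end

section
/- Let A ∈ ℤ^{n×n} be an indecomposable, invertible generalized Cartan matrix (not necessarily simply-laced). Define endomorphisms s₁,…,sₙ of ℝⁿ on the standard basis by s_i(e_j) := e_j − A_{ij}·e_i (the fundamental Weyl reflections written in the simple-root basis of 𝔥*). Then the only subspaces U ⊆ ℝⁿ with s_i(U) ⊆ U for all i = 1,…,n are {0} and ℝⁿ; i.e. 𝔥* is an irreducible module for the Weyl group W(A). -/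
open scoped BigOperators

noncomputable section

/-- The fundamental Weyl reflection `s_i` written in the simple-root basis of `𝔥*`:
`s_i(e_j) = e_j − A_{ij}·e_i`, i.e. `s_i(x) = x − (Σ_j A_{ij} x_j)·e_i`. -/
def weylRefl {n : ℕ} (A : Matrix (Fin n) (Fin n) ℤ) (i : Fin n) :
    Module.End ℝ (Fin n → ℝ) :=
  LinearMap.id - LinearMap.smulRight
    (∑ j, (A i j : ℝ) • LinearMap.proj j : (Fin n → ℝ) →ₗ[ℝ] ℝ) (Pi.single i 1)

theorem weylRefl_apply {n : ℕ} (A : Matrix (Fin n) (Fin n) ℤ) (i : Fin n) (x : Fin n → ℝ) :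
    weylRefl A i x = x - (A.map ((↑) : ℤ → ℝ)).mulVec x i • Pi.single i 1 := by
  simp [weylRefl, Matrix.mulVec, dotProduct]

/-- An invariant subspace contains `e_i` as soon as some vector of it is moved by `s_i`. -/
theorem single_mem_of_weylRefl_mem {n : ℕ} {A : Matrix (Fin n) (Fin n) ℤ}
    {U : Submodule ℝ (Fin n → ℝ)} {i : Fin n} {x : Fin n → ℝ} (hx : x ∈ U)
    (hsx : weylRefl A i x ∈ U) (hne : (A.map ((↑) : ℤ → ℝ)).mulVec x i ≠ 0) :
    Pi.single i 1 ∈ U := by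
  rw [weylRefl_apply] at hsx
  have h := U.sub_mem hx hsx
  rw [sub_sub_cancel] at h
  exact (U.smul_mem_iff hne).1 h

/-- For an indecomposable, invertible (regular) GCM `A`, the standard representation of
the Weyl group on `𝔥*` is irreducible: the only invariant subspaces are `{0}` and all. -/
theorem statement12 {n : ℕ} (A : Matrix (Fin n) (Fin n) ℤ)
    (hdiag : ∀ i, A i i = 2)
    (hoff : ∀ i j, i ≠ j → A i j ≤ 0)
    (hzero : ∀ i j, A i j = 0 ↔ A j i = 0)
    (hconn : ∀ i j : Fin n, Relation.ReflTransGen (fun a b => a ≠ b ∧ A a b ≠ 0) i j)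
    (hreg : (A.map ((↑) : ℤ → ℝ)).det ≠ 0) :
    ∀ U : Submodule ℝ (Fin n → ℝ),
      (∀ i, ∀ x ∈ U, weylRefl A i x ∈ U) → U = ⊥ ∨ U = ⊤ := by
  intro U hU
  refine or_iff_not_imp_left.2 fun hbot => ?_
  obtain ⟨x, hx, hx0⟩ := U.ne_bot_iff.1 hbot
  obtain ⟨i, hi⟩ : ∃ i, (A.map ((↑) : ℤ → ℝ)).mulVec x i ≠ 0 := by
    by_contra! h
    exact hx0 (Matrix.eq_zero_of_mulVec_eq_zero hreg (funext h))
  have hsingle : ∀ j, (Pi.single j 1 : Fin n → ℝ) ∈ U := by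
    intro j
    induction hconn i j with
    | refl => exact single_mem_of_weylRefl_mem hx (hU i x hx) hi
    | @tail b c _ hbc ih =>
      refine single_mem_of_weylRefl_mem ih (hU c _ ih) ?_
      simpa using fun h => hbc.2 ((hzero b c).2 h)
  refine eq_top_iff.2 fun y _ => ?_
  rw [pi_eq_sum_univ' y]
  refine U.sum_mem fun j _ => U.smul_mem _ ?_
  convert hsingle j using 1
end
end

section
/- Let A be an indecomposable, invertible, simply-laced GCM with n ≥ 2. Let V := ℝⁿ with the nondegenerate symmetric bilinear form b(x,y) := xᵀAy, let α_i := e_i be the standard basis, and s_i := s_{α_i}. Let M₁,…,Mₙ be a generalized spin representation on a finite-dimensional real vector space S such that the only subspaces of S invariant under every M_i are {0} and S. Set T_i := (s_i − ½·id_V) ⊗ (2M_i) ∈ End(V ⊗ S). Then the only subspaces of V ⊗ S invariant under every T_i are {0} and V ⊗ S; i.e. the 3/2-spin representation 𝒮_{3/2} built on an irreducible generalized spin representation is irreducible. -/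
open scoped TensorProduct BigOperators

noncomputable section

/-- The bilinear form `b(x,y) = xᵀAy` on `ℝⁿ`. -/
def formA {n : ℕ} (A : Matrix (Fin n) (Fin n) ℤ) :
    LinearMap.BilinForm ℝ (Fin n → ℝ) :=
  Matrix.toBilin' (A.map ((↑) : ℤ → ℝ))

/-- Contraction of the first tensor factor with a linear functional. -/
def contractFst {V S : Type*} [AddCommGroup V] [Module ℝ V] [AddCommGroup S] [Module ℝ S]
    (f : V →ₗ[ℝ] ℝ) : V ⊗[ℝ] S →ₗ[ℝ] S :=
  (TensorProduct.lid ℝ S).toLinearMap ∘ₗ f.rTensor S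

section General

variable {V S : Type*} [AddCommGroup V] [Module ℝ V] [AddCommGroup S] [Module ℝ S]

lemma contractFst_tmul (f : V →ₗ[ℝ] ℝ) (v : V) (s : S) :
    contractFst f (v ⊗ₜ[ℝ] s) = f v • s := by
  simp [contractFst]

lemma tmul_contractFst_tmul_contractFst (f g : V →ₗ[ℝ] ℝ) (v w : V) (x : V ⊗[ℝ] S) :
    v ⊗ₜ[ℝ] contractFst f (w ⊗ₜ[ℝ] contractFst g x) = f w • (v ⊗ₜ[ℝ] contractFst g x) := by
  rw [contractFst_tmul, TensorProduct.tmul_smul]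

/-- The square of `(s_α − ½) ⊗ 2M` is `(s_α − 5/4) ⊗ 1` when `M² = −¼`. -/
lemma map_refl_sub_half_sq (b : LinearMap.BilinForm ℝ V) (α : V) (hα : b α α = 2)
    (M : Module.End ℝ S) (hM : M * M = (-(1/4 : ℝ)) • (1 : Module.End ℝ S)) (x : V ⊗[ℝ] S) :
    TensorProduct.map (reflB b α - (1/2 : ℝ) • 1) ((2:ℝ) • M)
      (TensorProduct.map (reflB b α - (1/2 : ℝ) • 1) ((2:ℝ) • M) x) =
      (-(1/4 : ℝ)) • x - α ⊗ₜ[ℝ] contractFst (b α) x := by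
  have hM' : ∀ s, M (M s) = (-(1/4 : ℝ)) • s := fun s => by
    simpa using LinearMap.congr_fun hM s
  induction x with
  | zero => simp
  | add x y hx hy =>
    simp only [map_add, hx, hy, TensorProduct.tmul_add, smul_add]
    abel
  | tmul v s =>
    simp only [reflB, TensorProduct.map_tmul, LinearMap.sub_apply, LinearMap.smul_apply,
      LinearMap.id_apply, LinearMap.smulRight_apply, Module.End.one_apply, map_sub, map_smul,
      hα, hM', contractFst_tmul, TensorProduct.sub_tmul, ← TensorProduct.smul_tmul',
      TensorProduct.tmul_smul, smul_sub, smul_smul]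
    module

/-- The operator `1 ⊗ M` in terms of `(s_α − ½) ⊗ 2M` and the rank-one operator of `α`. -/
lemma lTensor_eq_map_refl (b : LinearMap.BilinForm ℝ V) (α : V) (hα : b α α = 2)
    (M : Module.End ℝ S) (x : V ⊗[ℝ] S) :
    (3/2 : ℝ) • M.lTensor V x =
      (3/2 : ℝ) • TensorProduct.map (reflB b α - (1/2 : ℝ) • 1) ((2:ℝ) • M) x -
        α ⊗ₜ[ℝ] contractFst (b α)
          (TensorProduct.map (reflB b α - (1/2 : ℝ) • 1) ((2:ℝ) • M) x) := by
  induction x with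
  | zero => simp
  | add x y hx hy =>
    simp only [map_add, hx, hy, TensorProduct.tmul_add, smul_add]
    abel
  | tmul v s =>
    simp only [reflB, TensorProduct.map_tmul, LinearMap.sub_apply, LinearMap.smul_apply,
      LinearMap.id_apply, LinearMap.smulRight_apply, Module.End.one_apply, map_sub, map_smul,
      LinearMap.lTensor_tmul,
      hα, contractFst_tmul, TensorProduct.sub_tmul, ← TensorProduct.smul_tmul',
      TensorProduct.tmul_sub, TensorProduct.tmul_smul, smul_sub, smul_smul]
    module

end General

section Coordinates

variable {n : ℕ} {S : Type*} [AddCommGroup S] [Module ℝ S]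

lemma formA_single_single (A : Matrix (Fin n) (Fin n) ℤ) (i j : Fin n) :
    formA A (Pi.single i 1) (Pi.single j 1) = (A i j : ℝ) := by
  simp [formA, Matrix.toBilin'_single]

lemma sum_single_tmul_contractFst_proj (x : (Fin n → ℝ) ⊗[ℝ] S) :
    ∑ k, (Pi.single k 1 : Fin n → ℝ) ⊗ₜ[ℝ] contractFst (LinearMap.proj k) x = x := by
  induction x with
  | zero => simp
  | add x y hx hy =>
    simp only [map_add, TensorProduct.tmul_add, Finset.sum_add_distrib, hx, hy]
  | tmul v s =>
    simp only [contractFst_tmul, LinearMap.proj_apply, ← TensorProduct.smul_tmul,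
      ← TensorProduct.sum_tmul]
    congr 1
    exact (pi_eq_sum_univ' v).symm

lemma contractFst_formA_single (A : Matrix (Fin n) (Fin n) ℤ) (j : Fin n)
    (x : (Fin n → ℝ) ⊗[ℝ] S) :
    contractFst (formA A (Pi.single j 1)) x =
      ∑ k, (A j k : ℝ) • contractFst (LinearMap.proj k) x := by
  conv_lhs => rw [← sum_single_tmul_contractFst_proj x]
  simp only [map_sum, contractFst_tmul, formA_single_single]

/-- Contractions with the functionals `b(e_j, ·)` separate points when `A` is invertible. -/
lemma eq_zero_of_contractFst_formA_eq_zero (A : Matrix (Fin n) (Fin n) ℤ)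
    (hreg : (A.map ((↑) : ℤ → ℝ)).det ≠ 0) (x : (Fin n → ℝ) ⊗[ℝ] S)
    (hx : ∀ j, contractFst (formA A (Pi.single j 1)) x = 0) : x = 0 := by
  set B := A.map ((↑) : ℤ → ℝ)
  have hinv : B⁻¹ * B = 1 := Matrix.nonsing_inv_mul B (isUnit_iff_ne_zero.mpr hreg)
  rw [← sum_single_tmul_contractFst_proj x]
  refine Finset.sum_eq_zero fun i _ => ?_
  have key : contractFst (LinearMap.proj i) x =
      ∑ j, B⁻¹ i j • contractFst (formA A (Pi.single j 1)) x := by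
    simp only [contractFst_formA_single, Finset.smul_sum, smul_smul]
    rw [Finset.sum_comm]
    simp only [← Finset.sum_smul]
    have hentry : ∀ k, ∑ j, B⁻¹ i j * (A j k : ℝ) = (1 : Matrix (Fin n) (Fin n) ℝ) i k :=
      fun k => by rw [← hinv, Matrix.mul_apply]; rfl
    simp [hentry, Matrix.one_apply]
  simp [key, hx]

end Coordinates

/-- Irreducibility of the 3/2-spin representation: for an indecomposable, invertible,
simply-laced GCM `A` and an irreducible generalized spin representation `M₁,…,Mₙ` on `S`,
the operators `T_i = (s_i − ½·id) ⊗ (2M_i)` admit no nontrivial invariant subspace of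
`V ⊗ S`. -/
theorem statement13 {n : ℕ} (hn : 2 ≤ n) (A : Matrix (Fin n) (Fin n) ℤ)
    (hdiag : ∀ i, A i i = 2)
    (hoffdiag : ∀ i j, i ≠ j → A i j = 0 ∨ A i j = -1)
    (hzero : ∀ i j, A i j = 0 ↔ A j i = 0)
    (hconn : ∀ i j : Fin n, Relation.ReflTransGen (fun a b => a ≠ b ∧ A a b ≠ 0) i j)
    (hreg : (A.map ((↑) : ℤ → ℝ)).det ≠ 0)
    {S : Type*} [AddCommGroup S] [Module ℝ S] [FiniteDimensional ℝ S]
    (M : Fin n → Module.End ℝ S)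
    (hsq : ∀ i, M i * M i = (-(1/4 : ℝ)) • (1 : Module.End ℝ S))
    (hcomm : ∀ i j, i ≠ j → A i j = 0 → M i * M j = M j * M i)
    (hanti : ∀ i j, i ≠ j → A i j = -1 → M i * M j = -(M j * M i))
    (hirr : ∀ W : Submodule ℝ S, (∀ i, ∀ x ∈ W, M i x ∈ W) → W = ⊥ ∨ W = ⊤) :
    ∀ U : Submodule ℝ ((Fin n → ℝ) ⊗[ℝ] S),
      (∀ i, ∀ x ∈ U,
        TensorProduct.map (reflB (formA A) (Pi.single i 1) - (1/2 : ℝ) • 1) ((2:ℝ) • M i) x ∈ U)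
      → U = ⊥ ∨ U = ⊤ := by
  intro U hU
  have hα : ∀ i, formA A (Pi.single i 1) (Pi.single i 1) = 2 := fun i => by
    rw [formA_single_single, hdiag]; norm_num
  have hdiagU : ∀ i, ∀ x ∈ U, (Pi.single i 1 : Fin n → ℝ) ⊗ₜ[ℝ]
      contractFst (formA A (Pi.single i 1)) x ∈ U := fun i x hx => by
    have h := hU i _ (hU i x hx)
    rw [map_refl_sub_half_sq _ _ (hα i) _ (hsq i)] at h
    exact (U.sub_mem_iff_right (U.smul_mem _ hx)).mp h
  have hMU : ∀ i, ∀ x ∈ U, (M i).lTensor (Fin n → ℝ) x ∈ U := fun i x hx => by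
    have h : (3/2 : ℝ) • (M i).lTensor (Fin n → ℝ) x ∈ U := by
      rw [lTensor_eq_map_refl _ _ (hα i)]
      exact U.sub_mem (U.smul_mem _ (hU i x hx)) (hdiagU i _ (hU i x hx))
    exact (U.smul_mem_iff (by norm_num)).mp h
  have hrank : ∀ i j, ∀ x ∈ U, (Pi.single i 1 : Fin n → ℝ) ⊗ₜ[ℝ]
      contractFst (formA A (Pi.single j 1)) x ∈ U := by
    intro i j
    induction hconn i j with
    | refl => exact hdiagU i
    | @tail j k _ hjk ih =>
      intro x hx
      have h := ih _ (hdiagU k x hx)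
      rw [tmul_contractFst_tmul_contractFst, formA_single_single] at h
      exact (U.smul_mem_iff (Int.cast_ne_zero.mpr hjk.2)).mp h
  let W : Submodule ℝ S :=
    ⨅ i : Fin n, U.comap (TensorProduct.mk ℝ (Fin n → ℝ) S (Pi.single i 1))
  have hW : ∀ s, s ∈ W ↔ ∀ i, (Pi.single i 1 : Fin n → ℝ) ⊗ₜ[ℝ] s ∈ U := fun s => by
    simp [W, Submodule.mem_iInf]
  rcases hirr W fun i s hs => (hW _).mpr fun k => hMU i _ ((hW s).mp hs k) with h | h
  · refine Or.inl ((Submodule.eq_bot_iff U).mpr fun x hx => ?_)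
    refine eq_zero_of_contractFst_formA_eq_zero A hreg x fun j => ?_
    rw [← Submodule.mem_bot ℝ, ← h]
    exact (hW _).mpr fun i => hrank i j x hx
  · refine Or.inr ((Submodule.eq_top_iff').mpr fun x => ?_)
    rw [← sum_single_tmul_contractFst_proj x]
    exact U.sum_mem fun k _ => (hW _).mp (h ▸ Submodule.mem_top) k
end
end

section
/- Let A be an indecomposable, invertible, simply-laced GCM, V := ℝⁿ with b(x,y) := xᵀAy, (e_k) the standard basis with inverse Gram matrix (ω^{kl}) of b, and Ψ := Σ_{k,l} ω^{kl}·e_k ⊗ e_l ∈ V ⊗ V. Let M₁,…,Mₙ be a generalized spin representation on S, equipped with an inner product ⟨·,·⟩_S for which every M_i is skew-adjoint, and on (V ⊗ V) ⊗ S set T_i := ((s_i ⊗ s_i) − ½·id) ⊗ (2M_i). Then: (i) (s_i ⊗ s_i)(Ψ) = Ψ for all i; (ii) T_i(Ψ ⊗ u) = Ψ ⊗ (M_i u) for all u ∈ S, so ℝΨ ⊗ S is an invariant submodule on which the action coincides with the generalized spin representation 𝒮_{1/2}; (iii) (b⊗b)(Ψ,Ψ) = n ≠ 0, and the orthogonal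 complement S̃ of ℝΨ ⊗ S inside Sym²(V) ⊗ S with respect to the bilinear form (b⊗b) ⊗ ⟨·,·⟩_S is invariant under every T_i; (iv) Sym²(V) ⊗ S = (ℝΨ ⊗ S) ⊕ S̃. Thus 𝒮_{5/2} decomposes as an orthogonal direct sum of invariant submodules S̃ ⊕ 𝒮_{1/2}. -/
open scoped TensorProduct BigOperators

noncomputable section

/-- The induced action `s_i ⊗ s_i` on `V ⊗ V` for `V = ℝⁿ`. -/
def ssA {n : ℕ} (A : Matrix (Fin n) (Fin n) ℤ) (i : Fin n) :
    Module.End ℝ ((Fin n → ℝ) ⊗[ℝ] (Fin n → ℝ)) :=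
  TensorProduct.map (reflB (formA A) (Pi.single i 1)) (reflB (formA A) (Pi.single i 1))

/-- The operator `T_i = ((s_i⊗s_i) − ½·id) ⊗ (2M_i)` of the 5/2-spin representation. -/
def T52A {n : ℕ} (A : Matrix (Fin n) (Fin n) ℤ) {S : Type*}
    [AddCommGroup S] [Module ℝ S] (M : Fin n → Module.End ℝ S) (i : Fin n) :
    Module.End ℝ (((Fin n → ℝ) ⊗[ℝ] (Fin n → ℝ)) ⊗[ℝ] S) :=
  TensorProduct.map (ssA A i - (1/2 : ℝ) • 1) ((2:ℝ) • M i)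

/-- The symmetric element `Ψ = Σ_{k,l} ω^{kl}·e_k ⊗ e_l`. -/
def PsiElt {n : ℕ} (ωInv : Matrix (Fin n) (Fin n) ℝ) :
    (Fin n → ℝ) ⊗[ℝ] (Fin n → ℝ) :=
  ∑ k, ∑ l, ωInv k l • ((Pi.single k 1 : Fin n → ℝ) ⊗ₜ[ℝ] (Pi.single l 1 : Fin n → ℝ))

/-- The submodule `Sym²(V) ⊗ S`, the fixed space of the flip of the two `V`-factors. -/
def symS {n : ℕ} (S : Type*) [AddCommGroup S] [Module ℝ S] :
    Submodule ℝ (((Fin n → ℝ) ⊗[ℝ] (Fin n → ℝ)) ⊗[ℝ] S) :=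
  LinearMap.eqLocus
    (TensorProduct.map (TensorProduct.comm ℝ (Fin n → ℝ) (Fin n → ℝ)).toLinearMap
      (LinearMap.id : S →ₗ[ℝ] S))
    LinearMap.id

/-- The contravariant form `(b⊗b) ⊗ ⟨·,·⟩_S` on `(V ⊗ V) ⊗ S`. -/
def formBB {n : ℕ} (A : Matrix (Fin n) (Fin n) ℤ) {S : Type*}
    [AddCommGroup S] [Module ℝ S] (bS : LinearMap.BilinForm ℝ S) :
    LinearMap.BilinForm ℝ (((Fin n → ℝ) ⊗[ℝ] (Fin n → ℝ)) ⊗[ℝ] S) :=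
  LinearMap.BilinForm.tmul (LinearMap.BilinForm.tmul (formA A) (formA A)) bS

/-- The submodule `ℝΨ ⊗ S`. -/
def PsiS {n : ℕ} (ωInv : Matrix (Fin n) (Fin n) ℝ) (S : Type*)
    [AddCommGroup S] [Module ℝ S] :
    Submodule ℝ (((Fin n → ℝ) ⊗[ℝ] (Fin n → ℝ)) ⊗[ℝ] S) :=
  LinearMap.range (TensorProduct.mk ℝ ((Fin n → ℝ) ⊗[ℝ] (Fin n → ℝ)) S (PsiElt ωInv))

/-- The contraction `(x ⊗ y) ⊗ u ↦ b(x, y) u`. -/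
def contractA {n : ℕ} (A : Matrix (Fin n) (Fin n) ℤ) (S : Type*)
    [AddCommGroup S] [Module ℝ S] :
    ((Fin n → ℝ) ⊗[ℝ] (Fin n → ℝ)) ⊗[ℝ] S →ₗ[ℝ] S :=
  (TensorProduct.lid ℝ S).toLinearMap ∘ₗ
    TensorProduct.map (TensorProduct.lift (formA A)) LinearMap.id

@[simp]
theorem contractA_tmul {n : ℕ} (A : Matrix (Fin n) (Fin n) ℤ) {S : Type*}
    [AddCommGroup S] [Module ℝ S] (p : (Fin n → ℝ) ⊗[ℝ] (Fin n → ℝ)) (u : S) :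
    contractA A S (p ⊗ₜ[ℝ] u) = TensorProduct.lift (formA A) p • u := by
  simp [contractA]

theorem formA_single {n : ℕ} (A : Matrix (Fin n) (Fin n) ℤ) (i j : Fin n) :
    formA A (Pi.single i 1) (Pi.single j 1) = (A i j : ℝ) := by
  simp [formA]

theorem formA_single_left {n : ℕ} (A : Matrix (Fin n) (Fin n) ℤ) (i : Fin n)
    (x : Fin n → ℝ) : formA A (Pi.single i 1) x = ∑ j, (A i j : ℝ) * x j := by
  simp [formA, Matrix.toBilin'_apply', Matrix.mulVec_eq_sum, mul_comm]

/-- A simply-laced generalized Cartan matrix is symmetric. -/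
theorem simplyLaced_symm {n : ℕ} {A : Matrix (Fin n) (Fin n) ℤ}
    (hoffdiag : ∀ i j, i ≠ j → A i j = 0 ∨ A i j = -1)
    (hzero : ∀ i j, A i j = 0 ↔ A j i = 0) (i j : Fin n) : A i j = A j i := by
  by_cases h : i = j
  · rw [h]
  · have := hzero i j
    rcases hoffdiag i j h with h1 | h1 <;> rcases hoffdiag j i (Ne.symm h) with h2 | h2 <;> lia

theorem formA_comm {n : ℕ} {A : Matrix (Fin n) (Fin n) ℤ} (hA : ∀ i j, A i j = A j i)
    (x y : Fin n → ℝ) : formA A x y = formA A y x := by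
  simp only [formA, Matrix.toBilin'_apply, Matrix.map_apply]
  rw [Finset.sum_comm]
  refine Finset.sum_congr rfl fun i _ => Finset.sum_congr rfl fun j _ => ?_
  rw [hA i j]
  ring

/-- A reflection in a vector of norm two is an isometry. -/
theorem reflB_isometry {V : Type*} [AddCommGroup V] [Module ℝ V]
    {b : LinearMap.BilinForm ℝ V} (hb : ∀ x y, b x y = b y x) {α : V} (hα : b α α = 2)
    (x y : V) : b (reflB b α x) (reflB b α y) = b x y := by
  simp only [reflB, LinearMap.sub_apply, LinearMap.id_apply, LinearMap.smulRight_apply,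
    map_sub, map_smul, LinearMap.smul_apply, smul_eq_mul, hα, hb x α]
  ring

/-- `Ψ` pairs each `e_k` with the `k`-th row of `ω`, which is the dual basis vector of `e_k`. -/
theorem PsiElt_eq_sum {n : ℕ} (ωInv : Matrix (Fin n) (Fin n) ℝ) :
    PsiElt ωInv = ∑ k, (Pi.single k 1 : Fin n → ℝ) ⊗ₜ[ℝ] ωInv.row k := by
  unfold PsiElt
  refine Finset.sum_congr rfl fun k _ => ?_
  conv_rhs => rw [pi_eq_sum_univ' (ωInv.row k)]
  simp [TensorProduct.tmul_sum]

theorem reflB_single {n : ℕ} (A : Matrix (Fin n) (Fin n) ℤ) (i k : Fin n) :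
    reflB (formA A) (Pi.single i 1) (Pi.single k 1) =
      Pi.single k 1 - (A i k : ℝ) • (Pi.single i 1 : Fin n → ℝ) := by
  simp only [reflB, LinearMap.sub_apply, LinearMap.id_apply, LinearMap.smulRight_apply,
    formA_single]

section Inverse

variable {n : ℕ} {A : Matrix (Fin n) (Fin n) ℤ} {ωInv : Matrix (Fin n) (Fin n) ℝ}

theorem inverse_symm (hA : ∀ i j, A i j = A j i)
    (hωr : A.map ((↑) : ℤ → ℝ) * ωInv = 1) (k l : Fin n) : ωInv k l = ωInv l k := by
  have hAT : (A.map ((↑) : ℤ → ℝ)).transpose = A.map ((↑) : ℤ → ℝ) := by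
    ext i j
    simp [hA i j]
  have h : ωInv.transpose * A.map ((↑) : ℤ → ℝ) = 1 := by
    rw [← hAT, ← Matrix.transpose_mul, hωr, Matrix.transpose_one]
  have h' : ωInv.transpose = ωInv := left_inv_eq_right_inv h hωr
  exact congrFun (congrFun h'.symm k) l

theorem formA_single_inverse_row (hA : ∀ i j, A i j = A j i)
    (hωl : ωInv * A.map ((↑) : ℤ → ℝ) = 1) (i k : Fin n) :
    formA A (Pi.single i 1) (ωInv.row k) = if k = i then 1 else 0 := by
  have h := congrFun (congrFun hωl k) i
  rw [Matrix.mul_apply, Matrix.one_apply] at h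
  rw [formA_single_left, ← h]
  refine Finset.sum_congr rfl fun j _ => ?_
  rw [Matrix.map_apply, hA i j, mul_comm, Matrix.row_apply]

theorem sum_smul_inverse_row (hωr : A.map ((↑) : ℤ → ℝ) * ωInv = 1) (i : Fin n) :
    ∑ k, (A i k : ℝ) • ωInv.row k = Pi.single i 1 := by
  ext j
  have h := congrFun (congrFun hωr i) j
  rw [Matrix.mul_apply] at h
  simp only [Finset.sum_apply, Pi.smul_apply, smul_eq_mul]
  simpa [Matrix.one_apply, Pi.single_apply, eq_comm] using h

theorem reflB_inverse_row (hA : ∀ i j, A i j = A j i)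
    (hωl : ωInv * A.map ((↑) : ℤ → ℝ) = 1) (i k : Fin n) :
    reflB (formA A) (Pi.single i 1) (ωInv.row k) =
      ωInv.row k - (if k = i then 1 else 0 : ℝ) • (Pi.single i 1 : Fin n → ℝ) := by
  simp only [reflB, LinearMap.sub_apply, LinearMap.id_apply, LinearMap.smulRight_apply,
    formA_single_inverse_row hA hωl]

theorem ssA_PsiElt (hdiag : ∀ i, A i i = 2) (hA : ∀ i j, A i j = A j i)
    (hωl : ωInv * A.map ((↑) : ℤ → ℝ) = 1) (hωr : A.map ((↑) : ℤ → ℝ) * ωInv = 1)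
    (i : Fin n) : ssA A i (PsiElt ωInv) = PsiElt ωInv := by
  have h1 : ∑ k, (A i k : ℝ) • ((Pi.single i 1 : Fin n → ℝ) ⊗ₜ[ℝ] ωInv.row k) =
      (Pi.single i 1 : Fin n → ℝ) ⊗ₜ[ℝ] (Pi.single i 1 : Fin n → ℝ) := by
    simp_rw [← TensorProduct.tmul_smul, ← TensorProduct.tmul_sum]
    rw [sum_smul_inverse_row hωr i]
  rw [PsiElt_eq_sum, map_sum]
  simp only [ssA, TensorProduct.map_tmul, reflB_single, reflB_inverse_row hA hωl,
    TensorProduct.sub_tmul, TensorProduct.tmul_sub, Finset.sum_sub_distrib,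
    TensorProduct.tmul_smul, ← TensorProduct.smul_tmul', h1]
  simp only [ite_smul, one_smul, zero_smul, Finset.sum_ite_eq', Finset.mem_univ, if_true, hdiag]
  push_cast
  module

theorem lift_formA_PsiElt (hA : ∀ i j, A i j = A j i)
    (hωl : ωInv * A.map ((↑) : ℤ → ℝ) = 1) :
    TensorProduct.lift (formA A) (PsiElt ωInv) = (n : ℝ) := by
  simp [PsiElt_eq_sum, formA_single_inverse_row hA hωl]

/-- Pairing with `Ψ` is the contraction by `b`. -/
theorem tmul_formA_PsiElt (hA : ∀ i j, A i j = A j i)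
    (hωl : ωInv * A.map ((↑) : ℤ → ℝ) = 1) (p : (Fin n → ℝ) ⊗[ℝ] (Fin n → ℝ)) :
    LinearMap.BilinForm.tmul (formA A) (formA A) (PsiElt ωInv) p =
      TensorProduct.lift (formA A) p := by
  suffices h : LinearMap.BilinForm.tmul (formA A) (formA A) (PsiElt ωInv) =
      TensorProduct.lift (formA A) by rw [h]
  refine TensorProduct.ext ?_
  refine LinearMap.pi_ext' fun i => LinearMap.ext_ring ?_
  refine LinearMap.pi_ext' fun j => LinearMap.ext_ring ?_
  simp [PsiElt_eq_sum, formA_single, formA_comm hA _ (Pi.single j 1),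
    formA_single_inverse_row hA hωl, hA]

theorem formBB_PsiElt_tmul (hA : ∀ i j, A i j = A j i)
    (hωl : ωInv * A.map ((↑) : ℤ → ℝ) = 1) {S : Type*} [AddCommGroup S] [Module ℝ S]
    (bS : LinearMap.BilinForm ℝ S) (u : S)
    (x : ((Fin n → ℝ) ⊗[ℝ] (Fin n → ℝ)) ⊗[ℝ] S) :
    formBB A bS (PsiElt ωInv ⊗ₜ[ℝ] u) x = bS u (contractA A S x) := by
  induction x with
  | zero => simp
  | add x y hx hy => rw [map_add, map_add, map_add, hx, hy]
  | tmul p v =>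
    simp [formBB, tmul_formA_PsiElt hA hωl, mul_comm]

theorem mem_orthogonal_PsiS_iff (hA : ∀ i j, A i j = A j i)
    (hωl : ωInv * A.map ((↑) : ℤ → ℝ) = 1) {S : Type*} [AddCommGroup S] [Module ℝ S]
    {bS : LinearMap.BilinForm ℝ S} (hpos : ∀ u : S, u ≠ 0 → 0 < bS u u)
    (x : ((Fin n → ℝ) ⊗[ℝ] (Fin n → ℝ)) ⊗[ℝ] S) :
    x ∈ (formBB A bS).orthogonal (PsiS ωInv S) ↔ contractA A S x = 0 := by
  rw [LinearMap.BilinForm.mem_orthogonal_iff]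
  constructor
  · intro h
    by_contra hne
    have h0 : formBB A bS (PsiElt ωInv ⊗ₜ[ℝ] contractA A S x) x = 0 := h _ ⟨_, rfl⟩
    rw [formBB_PsiElt_tmul hA hωl] at h0
    exact (hpos _ hne).ne' h0
  · rintro h _ ⟨u, rfl⟩
    change formBB A bS (PsiElt ωInv ⊗ₜ[ℝ] u) x = 0
    rw [formBB_PsiElt_tmul hA hωl, h, map_zero]

theorem comm_PsiElt (hω : ∀ k l, ωInv k l = ωInv l k) :
    TensorProduct.comm ℝ (Fin n → ℝ) (Fin n → ℝ) (PsiElt ωInv) = PsiElt ωInv := by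
  simp only [PsiElt, map_sum, map_smul, TensorProduct.comm_tmul]
  rw [Finset.sum_comm]
  simp_rw [hω]

end Inverse

theorem T52A_tmul {n : ℕ} (A : Matrix (Fin n) (Fin n) ℤ) {S : Type*}
    [AddCommGroup S] [Module ℝ S] (M : Fin n → Module.End ℝ S) (i : Fin n)
    (p : (Fin n → ℝ) ⊗[ℝ] (Fin n → ℝ)) (u : S) :
    T52A A M i (p ⊗ₜ[ℝ] u) = (ssA A i p - (1/2 : ℝ) • p) ⊗ₜ[ℝ] ((2:ℝ) • M i u) := by
  simp [T52A]

theorem lift_formA_ssA {n : ℕ} {A : Matrix (Fin n) (Fin n) ℤ} (hdiag : ∀ i, A i i = 2)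
    (hA : ∀ i j, A i j = A j i) (i : Fin n) (p : (Fin n → ℝ) ⊗[ℝ] (Fin n → ℝ)) :
    TensorProduct.lift (formA A) (ssA A i p) = TensorProduct.lift (formA A) p := by
  have h2 : formA A (Pi.single i 1) (Pi.single i 1) = 2 := by
    rw [formA_single, hdiag]; norm_num
  induction p with
  | zero => simp
  | add p q hp hq => rw [map_add, map_add, map_add, hp, hq]
  | tmul x y => simp [ssA, reflB_isometry (formA_comm hA) h2]

theorem contractA_T52A {n : ℕ} {A : Matrix (Fin n) (Fin n) ℤ} (hdiag : ∀ i, A i i = 2)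
    (hA : ∀ i j, A i j = A j i) {S : Type*} [AddCommGroup S] [Module ℝ S]
    (M : Fin n → Module.End ℝ S) (i : Fin n)
    (x : ((Fin n → ℝ) ⊗[ℝ] (Fin n → ℝ)) ⊗[ℝ] S) :
    contractA A S (T52A A M i x) = M i (contractA A S x) := by
  induction x with
  | zero => simp
  | add x y hx hy => rw [map_add, map_add, map_add, map_add, hx, hy]
  | tmul p u =>
    rw [T52A_tmul, contractA_tmul, contractA_tmul, map_sub, map_smul,
      lift_formA_ssA hdiag hA, map_smul, smul_smul]
    congr 1
    rw [smul_eq_mul]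
    ring

theorem comm_ssA {n : ℕ} (A : Matrix (Fin n) (Fin n) ℤ) (i : Fin n)
    (p : (Fin n → ℝ) ⊗[ℝ] (Fin n → ℝ)) :
    TensorProduct.comm ℝ (Fin n → ℝ) (Fin n → ℝ) (ssA A i p) =
      ssA A i (TensorProduct.comm ℝ (Fin n → ℝ) (Fin n → ℝ) p) := by
  induction p with
  | zero => simp
  | add p q hp hq => simp only [map_add, hp, hq]
  | tmul x y => simp [ssA]

theorem T52A_mem_symS {n : ℕ} (A : Matrix (Fin n) (Fin n) ℤ) {S : Type*}
    [AddCommGroup S] [Module ℝ S] (M : Fin n → Module.End ℝ S) (i : Fin n)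
    {x : ((Fin n → ℝ) ⊗[ℝ] (Fin n → ℝ)) ⊗[ℝ] S} (hx : x ∈ symS S) :
    T52A A M i x ∈ symS S := by
  have key : ∀ y : ((Fin n → ℝ) ⊗[ℝ] (Fin n → ℝ)) ⊗[ℝ] S,
      TensorProduct.map (TensorProduct.comm ℝ (Fin n → ℝ) (Fin n → ℝ)).toLinearMap
        (LinearMap.id : S →ₗ[ℝ] S) (T52A A M i y) =
      T52A A M i (TensorProduct.map
        (TensorProduct.comm ℝ (Fin n → ℝ) (Fin n → ℝ)).toLinearMap
        (LinearMap.id : S →ₗ[ℝ] S) y) := by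
    intro y
    induction y with
    | zero => simp
    | add y z hy hz => simp only [map_add, hy, hz]
    | tmul p u =>
      simp only [T52A_tmul, TensorProduct.map_tmul, LinearEquiv.coe_coe, LinearMap.id_apply,
        map_sub, map_smul, comm_ssA]
  rw [symS, LinearMap.mem_eqLocus, LinearMap.id_apply] at hx ⊢
  rw [key, hx]

/-- The decomposition `𝒮_{5/2} ≅ S̃ ⊕ 𝒮_{1/2}`: `ℝΨ ⊗ S` is an invariant submodule of
`Sym²(V) ⊗ S` on which the action is the generalized spin representation, and its
orthogonal complement w.r.t. the contravariant form is an invariant complement. -/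
theorem statement15 {n : ℕ} (hn : 0 < n) (A : Matrix (Fin n) (Fin n) ℤ)
    (hdiag : ∀ i, A i i = 2)
    (hoffdiag : ∀ i j, i ≠ j → A i j = 0 ∨ A i j = -1)
    (hzero : ∀ i j, A i j = 0 ↔ A j i = 0)
    (hconn : ∀ i j : Fin n, Relation.ReflTransGen (fun a b => a ≠ b ∧ A a b ≠ 0) i j)
    (hreg : (A.map ((↑) : ℤ → ℝ)).det ≠ 0)
    (ωInv : Matrix (Fin n) (Fin n) ℝ)
    (hωl : ωInv * A.map ((↑) : ℤ → ℝ) = 1)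
    (hωr : A.map ((↑) : ℤ → ℝ) * ωInv = 1)
    {S : Type*} [AddCommGroup S] [Module ℝ S] [FiniteDimensional ℝ S]
    (M : Fin n → Module.End ℝ S)
    (hsq : ∀ i, M i * M i = (-(1/4 : ℝ)) • (1 : Module.End ℝ S))
    (hcomm : ∀ i j, i ≠ j → A i j = 0 → M i * M j = M j * M i)
    (hanti : ∀ i j, i ≠ j → A i j = -1 → M i * M j = -(M j * M i))
    (bS : LinearMap.BilinForm ℝ S) (hbS : bS.IsSymm)
    (hpos : ∀ u : S, u ≠ 0 → 0 < bS u u)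
    (hskew : ∀ i, ∀ u v : S, bS (M i u) v = -bS u (M i v)) :
    (∀ i, ssA A i (PsiElt ωInv) = PsiElt ωInv) ∧
    (∀ i, ∀ u : S, T52A A M i (PsiElt ωInv ⊗ₜ[ℝ] u) = PsiElt ωInv ⊗ₜ[ℝ] (M i u)) ∧
    (LinearMap.BilinForm.tmul (formA A) (formA A) (PsiElt ωInv) (PsiElt ωInv) = (n : ℝ)
      ∧ (n : ℝ) ≠ 0) ∧
    (∀ i, ∀ x ∈ symS S ⊓ (formBB A bS).orthogonal (PsiS ωInv S),
      T52A A M i x ∈ symS S ⊓ (formBB A bS).orthogonal (PsiS ωInv S)) ∧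
    (PsiS ωInv S ⊔ (symS S ⊓ (formBB A bS).orthogonal (PsiS ωInv S)) = symS S) ∧
    (PsiS ωInv S ⊓ (symS S ⊓ (formBB A bS).orthogonal (PsiS ωInv S)) = ⊥) := by
  have hA := simplyLaced_symm hoffdiag hzero
  have hn0 : (n : ℝ) ≠ 0 := Nat.cast_ne_zero.mpr hn.ne'
  have hss := ssA_PsiElt hdiag hA hωl hωr
  have hmem := mem_orthogonal_PsiS_iff (S := S) hA hωl hpos
  have hPsi : PsiS ωInv S ≤ symS S := by
    rintro _ ⟨u, rfl⟩
    simp [symS, LinearMap.mem_eqLocus, comm_PsiElt (inverse_symm hA hωr)]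
  have hc : ∀ u : S, contractA A S (PsiElt ωInv ⊗ₜ[ℝ] u) = (n : ℝ) • u := fun u => by
    rw [contractA_tmul, lift_formA_PsiElt hA hωl]
  refine ⟨hss, fun i u => ?_, ⟨?_, hn0⟩, ?_, le_antisymm ?_ ?_, ?_⟩
  · have h : PsiElt ωInv - (1/2 : ℝ) • PsiElt ωInv = (1/2 : ℝ) • PsiElt ωInv := by module
    rw [T52A_tmul, hss, h, TensorProduct.smul_tmul, smul_smul]
    norm_num
  · rw [tmul_formA_PsiElt hA hωl, lift_formA_PsiElt hA hωl]
  · rintro i x ⟨hx, hx'⟩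
    refine ⟨T52A_mem_symS A M i hx, (hmem _).mpr ?_⟩
    rw [contractA_T52A hdiag hA, (hmem x).mp hx', map_zero]
  · exact sup_le hPsi inf_le_left
  · intro x hx
    have hp : ∀ u : S, PsiElt ωInv ⊗ₜ[ℝ] u ∈ PsiS ωInv S := fun u => ⟨u, rfl⟩
    refine Submodule.mem_sup.mpr ⟨_, hp ((n : ℝ)⁻¹ • contractA A S x),
      x + PsiElt ωInv ⊗ₜ[ℝ] (-((n : ℝ)⁻¹ • contractA A S x)),
      ⟨add_mem hx (hPsi (hp _)), (hmem _).mpr ?_⟩, ?_⟩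
    · rw [map_add, hc, smul_neg, smul_inv_smul₀ hn0, add_neg_cancel]
    · rw [add_left_comm, ← TensorProduct.tmul_add, add_neg_cancel, TensorProduct.tmul_zero,
        add_zero]
  · rw [eq_bot_iff]
    rintro _ ⟨⟨u, rfl⟩, -, hx⟩
    have h : contractA A S (PsiElt ωInv ⊗ₜ[ℝ] u) = 0 := (hmem _).mp hx
    rw [hc, smul_eq_zero_iff_right hn0] at h
    simp [h]
end
end

section
/- Let A be a simply-laced GCM, write (α|β) := αᵀAβ on ℤⁿ, let ε be the standard 2-cocycle of A, and let Γ : ℤⁿ → End(S) be a generalized Γ-matrix on a finite-dimensional real vector space S. For i ∈ {1,…,n} and φ ∈ ℝ set R_i(φ) := cos(φ/2)·id + sin(φ/2)·Γ(e_i) (the exponential exp(φ·½Γ(e_i)) of a Berman generator in the generalized spin representation ρ(X_i) = ½Γ(e_i)); note R_i(φ)∘R_i(−φ) = id. Then for every α ∈ ℤⁿ: (i) if (e_i|α) is even, then R_i(φ)∘Γ(α)∘R_i(−φ) = Γ(α) for all φ; (ii) if (e_i|α) is odd, then R_i(φ)∘Γ(α)∘R_i(−φ) = cos(φ)·Γ(α)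 + sin(φ)·Γ(e_i)∘Γ(α) for all φ, and in particular R_i(π/2)∘Γ(α)∘R_i(−π/2) = ε(e_i,α)·Γ(s_i·α), where s_i·α := α − (e_i|α)·e_i. -/
open scoped BigOperators

noncomputable section

/-- `R_i(φ) = cos(φ/2)·id + sin(φ/2)·Γ(e_i)`, the exponential of a Berman generator in
the generalized spin representation. -/
def Rrot {n : ℕ} {S : Type*} [AddCommGroup S] [Module ℝ S]
    (Γ : (Fin n → ℤ) → Module.End ℝ S) (i : Fin n) (φ : ℝ) : Module.End ℝ S :=
  Real.cos (φ/2) • (1 : Module.End ℝ S) + Real.sin (φ/2) • Γ (Pi.single i 1)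

section Cocycle

variable {n : ℕ}

theorem pairB_single_self (B : Matrix (Fin n) (Fin n) ℤ) (i : Fin n) :
    pairB B (Pi.single i 1) (Pi.single i 1) = B i i := by
  simp [pairB, Pi.single_apply]

theorem epsU_single_self (B : Matrix (Fin n) (Fin n) ℤ) (i : Fin n) :
    epsU B (Pi.single i 1) (Pi.single i 1) = B i i / 2 := by
  rw [epsU, Finset.sum_eq_single i, Finset.sum_eq_single i] <;>
    simp +contextual [Pi.single_apply]

theorem epsU_smul_right (B : Matrix (Fin n) (Fin n) ℤ) (k : ℤ) (α β : Fin n → ℤ) :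
    epsU B α (k • β) = k * epsU B α β := by
  simp only [epsU, Finset.mul_sum, Pi.smul_apply, smul_eq_mul]
  exact Finset.sum_congr rfl fun _ _ => Finset.sum_congr rfl fun _ _ => by ring

theorem stdCocycle_two_smul_right (B : Matrix (Fin n) (Fin n) ℤ) (α β : Fin n → ℤ) :
    stdCocycle B α ((2 : ℤ) • β) = 1 := by
  rw [stdCocycle, epsU_smul_right]
  exact (even_two_mul _).neg_one_zpow

end Cocycle

section Gamma

variable {n : ℕ} {S : Type*} [AddCommGroup S] [Module ℝ S] {A : Matrix (Fin n) (Fin n) ℤ}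
  {Γ : (Fin n → ℤ) → Module.End ℝ S}

theorem IsGammaMatrix.single_mul_self (hΓ : IsGammaMatrix A Γ) {i : Fin n} (hi : A i i = 2) :
    Γ (Pi.single i 1) * Γ (Pi.single i 1) = -1 := by
  rw [hΓ.2.2.1, pairB_single_self, hi]
  simp

/-- `Γ` is periodic with respect to twice a simple root. -/
theorem IsGammaMatrix.periodic_two_smul_single (hΓ : IsGammaMatrix A Γ) {i : Fin n}
    (hi : A i i = 2) : Function.Periodic Γ ((2 : ℤ) • Pi.single i 1) := by
  have h_one : Γ ((2 : ℤ) • Pi.single i 1) = 1 := by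
    have h := hΓ.2.2.2.2 (Pi.single i 1) (Pi.single i 1)
    rw [hΓ.single_mul_self hi, stdCocycle, epsU_single_self, hi, ← two_zsmul] at h
    simpa using h.symm
  intro β
  have h := hΓ.2.2.2.2 β ((2 : ℤ) • Pi.single i 1)
  rw [h_one, mul_one, stdCocycle_two_smul_right, one_smul] at h
  exact h.symm

theorem IsGammaMatrix.rrot_mul_rrot_neg (hΓ : IsGammaMatrix A Γ) {i : Fin n} (hi : A i i = 2)
    (φ : ℝ) : Rrot Γ i φ * Rrot Γ i (-φ) = 1 := by
  have hE := hΓ.single_mul_self hi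
  simp only [Rrot, neg_div, Real.cos_neg, Real.sin_neg, add_mul, mul_add, smul_mul_smul_comm,
    one_mul, mul_one, hE]
  calc _ = (Real.cos (φ / 2) ^ 2 + Real.sin (φ / 2) ^ 2) • (1 : Module.End ℝ S) := by module
    _ = 1 := by rw [Real.cos_sq_add_sin_sq, one_smul]

theorem IsGammaMatrix.rrot_conj_of_even (hΓ : IsGammaMatrix A Γ) {i : Fin n} (hi : A i i = 2)
    {α : Fin n → ℤ} (h : Even (pairB A (Pi.single i 1) α)) (φ : ℝ) :
    Rrot Γ i φ * Γ α * Rrot Γ i (-φ) = Γ α := by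
  have hcomm : Γ (Pi.single i 1) * Γ α = Γ α * Γ (Pi.single i 1) := by
    rw [hΓ.2.2.2.1, h.neg_one_zpow, one_smul]
  have hR : Rrot Γ i φ * Γ α = Γ α * Rrot Γ i φ := by
    simp [Rrot, add_mul, mul_add, hcomm]
  rw [hR, mul_assoc, hΓ.rrot_mul_rrot_neg hi, mul_one]

theorem IsGammaMatrix.rrot_conj_of_odd (hΓ : IsGammaMatrix A Γ) {i : Fin n} (hi : A i i = 2)
    {α : Fin n → ℤ} (h : Odd (pairB A (Pi.single i 1) α)) (φ : ℝ) :
    Rrot Γ i φ * Γ α * Rrot Γ i (-φ)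
      = Real.cos φ • Γ α + Real.sin φ • (Γ (Pi.single i 1) * Γ α) := by
  have hanti : Γ α * Γ (Pi.single i 1) = -(Γ (Pi.single i 1) * Γ α) := by
    rw [hΓ.2.2.2.1 (Pi.single i 1) α, h.neg_one_zpow, neg_one_smul, neg_neg]
  have hR : Γ α * Rrot Γ i (-φ) = Rrot Γ i φ * Γ α := by
    simp [Rrot, add_mul, mul_add, hanti, neg_div]
  have hcos : Real.cos φ = Real.cos (φ / 2) ^ 2 - Real.sin (φ / 2) ^ 2 := by
    rw [← Real.cos_two_mul', mul_div_cancel₀ φ two_ne_zero]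
  have hsin : Real.sin φ = 2 * Real.sin (φ / 2) * Real.cos (φ / 2) := by
    rw [← Real.sin_two_mul, mul_div_cancel₀ φ two_ne_zero]
  have hsq : Rrot Γ i φ * Rrot Γ i φ
      = Real.cos φ • (1 : Module.End ℝ S) + Real.sin φ • Γ (Pi.single i 1) := by
    simp only [Rrot, add_mul, mul_add, smul_mul_smul_comm, one_mul, mul_one,
      hΓ.single_mul_self hi, hcos, hsin]
    module
  rw [mul_assoc, hR, ← mul_assoc, hsq, add_mul, smul_mul_assoc, smul_mul_assoc, one_mul]

theorem IsGammaMatrix.rrot_pi_div_two_conj_of_odd (hΓ : IsGammaMatrix A Γ) {i : Fin n}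
    (hi : A i i = 2) {α : Fin n → ℤ} (h : Odd (pairB A (Pi.single i 1) α)) :
    Rrot Γ i (Real.pi / 2) * Γ α * Rrot Γ i (-(Real.pi / 2))
      = stdCocycle A (Pi.single i 1) α •
          Γ (α - pairB A (Pi.single i 1) α • Pi.single i 1) := by
  rw [hΓ.rrot_conj_of_odd hi h, Real.cos_pi_div_two, Real.sin_pi_div_two, zero_smul, zero_add,
    one_smul, hΓ.2.2.2.2]
  obtain ⟨k, hk⟩ := h
  rw [hk, ← (hΓ.periodic_two_smul_single hi).zsmul (k + 1) (α - _)]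
  congr 2
  module

end Gamma

/-- Conjugation of the Γ-matrices by the one-parameter groups `R_i(φ)`, realizing the
action of the spin-extended Weyl group on the generalized spin representation. -/
theorem statement18 {n : ℕ} (A : Matrix (Fin n) (Fin n) ℤ)
    (hdiag : ∀ i, A i i = 2)
    (hoffdiag : ∀ i j, i ≠ j → A i j = 0 ∨ A i j = -1)
    (hzero : ∀ i j, A i j = 0 ↔ A j i = 0)
    {S : Type*} [AddCommGroup S] [Module ℝ S] [FiniteDimensional ℝ S]
    (Γ : (Fin n → ℤ) → Module.End ℝ S) (hΓ : IsGammaMatrix A Γ) :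
    (∀ i φ, Rrot Γ i φ * Rrot Γ i (-φ) = 1) ∧
    (∀ (i : Fin n) (α : Fin n → ℤ), Even (pairB A (Pi.single i 1) α) →
      ∀ φ : ℝ, Rrot Γ i φ * Γ α * Rrot Γ i (-φ) = Γ α) ∧
    (∀ (i : Fin n) (α : Fin n → ℤ), Odd (pairB A (Pi.single i 1) α) →
      (∀ φ : ℝ, Rrot Γ i φ * Γ α * Rrot Γ i (-φ)
        = Real.cos φ • Γ α + Real.sin φ • (Γ (Pi.single i 1) * Γ α)) ∧
      Rrot Γ i (Real.pi/2) * Γ α * Rrot Γ i (-(Real.pi/2))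
        = stdCocycle A (Pi.single i 1) α •
            Γ (α - pairB A (Pi.single i 1) α • Pi.single i 1)) := by
  exact ⟨fun i φ => hΓ.rrot_mul_rrot_neg (hdiag i) φ,
    fun i _ h φ => hΓ.rrot_conj_of_even (hdiag i) h φ,
    fun i _ h => ⟨fun φ => hΓ.rrot_conj_of_odd (hdiag i) h φ,
      hΓ.rrot_pi_div_two_conj_of_odd (hdiag i) h⟩⟩
end
end
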